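/- arXiv:1912.06855 — 2 statements merged into one kernel-verified Lean document; each statement's English description precedes it below -/
import Mathlib

section
/- Let (r_m) be positive reals with r_m → 0 and (y_m) nonnegative reals with r_m²·y_m → 0, and set q_m = e^{−r_m}. Then for every x ∈ ℝ, lim_{m→∞} Prob_{q_m, y_m}( λ_1 ≤ r_m^{−1}·ln( r_m^{−1}·I_0(2y_m + r_m y_m) ) + x·r_m^{−1} ) = exp(−e^{−x}), where I_0(z) = (1/2π) ∫_{−π}^{π} e^{z cos φ} dφ and λ_1 denotes the largest part of λ. That is, in the high-temperature regime of the cylindric Plancherel measure, the centered and rescaled largest part converges in distribution to the Gumbel law. -/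
/-- An integer partition: a weakly decreasing sequence of nonnegative integers with only
finitely many nonzero terms; `part i` is the `(i+1)`-st part `λ_{i+1}`. -/
structure IntPartition where
  part : ℕ → ℕ
  antitone : Antitone part
  finite_supp : (Function.support part).Finite

/-- The size `|λ| = Σ_i λ_i` of a partition. -/
noncomputable def IntPartition.size (lam : IntPartition) : ℕ := ∑ᶠ i, lam.part i

/-- `dim(λ/μ)`: the number of saturated chains `μ = ν⁰ ⊆ ν¹ ⊆ ⋯ ⊆ νᵐ = λ` of partitions
with `|νᵏ| = |νᵏ⁻¹| + 1` for all `k`, where `m = |λ| − |μ|` (equivalently, the number of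
standard Young tableaux of skew shape `λ/μ`); chains are encoded as sequences
`f : ℕ → IntPartition` constant equal to `λ` from index `m` on. -/
noncomputable def skewDim (mu lam : IntPartition) : ℕ :=
  Set.ncard {f : ℕ → IntPartition |
    f 0 = mu ∧ (∀ k : ℕ, lam.size - mu.size ≤ k → f k = lam) ∧
    ∀ k : ℕ, k < lam.size - mu.size →
      (∀ i : ℕ, (f k).part i ≤ (f (k + 1)).part i) ∧ (f (k + 1)).size = (f k).size + 1}

/-- The modified Bessel function `I₀(z) = (1/(2π)) ∫_{−π}^{π} e^{z cos φ} dφ`. -/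
noncomputable def besselI0 (z : ℝ) : ℝ :=
  (1 / (2 * Real.pi)) * ∫ φ in (-Real.pi)..Real.pi, Real.exp (z * Real.cos φ)

open scoped Classical in
/-- The (unnormalized) cylindric Plancherel weight
`W(λ) = Σ_{μ ⊆ λ} q^{|μ|} ( dim(λ/μ) y^{|λ|−|μ|} / (|λ|−|μ|)! )²`. -/
noncomputable def cpmWeight (q y : ℝ) (lam : IntPartition) : ℝ :=
  ∑' mu : IntPartition,
    if ∀ i : ℕ, mu.part i ≤ lam.part i then
      q ^ mu.size *
        ((skewDim mu lam : ℝ) * y ^ (lam.size - mu.size) /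
          (Nat.factorial (lam.size - mu.size) : ℝ)) ^ 2
    else 0

/-- The coefficient of `u ^ k` in `exp (y * u)`, for an integer exponent `k`. -/
noncomputable def expCoeff (y : ℝ) (k : ℤ) : ℝ :=
  if k < 0 then 0 else y ^ k.toNat / (k.toNat.factorial : ℝ)

theorem expCoeff_of_neg (y : ℝ) {k : ℤ} (hk : k < 0) : expCoeff y k = 0 := by
  simp [expCoeff, hk]

theorem expCoeff_natCast (y : ℝ) (n : ℕ) : expCoeff y n = y ^ n / (n.factorial : ℝ) := by
  simp [expCoeff]

theorem expCoeff_zero (y : ℝ) : expCoeff y 0 = 1 := by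
  simpa using expCoeff_natCast y 0

theorem intCast_mul_expCoeff (y : ℝ) (k : ℤ) :
    (k : ℝ) * expCoeff y k = y * expCoeff y (k - 1) := by
  rcases lt_trichotomy k 0 with hk | rfl | hk
  · rw [expCoeff_of_neg y hk, expCoeff_of_neg y (by lia)]; simp
  · rw [expCoeff_of_neg y (k := 0 - 1) (by lia)]; simp
  · obtain ⟨n, rfl⟩ : ∃ n : ℕ, k = n + 1 := ⟨(k - 1).toNat, by lia⟩
    have h := expCoeff_natCast y (n + 1)
    push_cast at h
    rw [h, add_sub_cancel_right, expCoeff_natCast, Nat.factorial_succ]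
    push_cast
    have : (n.factorial : ℝ) ≠ 0 := by positivity
    field_simp
    ring

/-- The minor of the Toeplitz matrix of `exp (y * u)` with rows `x` and columns `z`. -/
noncomputable def expMinor (y : ℝ) {M : ℕ} (x z : Fin M → ℤ) : ℝ :=
  Matrix.det (Matrix.of fun i j => expCoeff y (x i - z j))

theorem mul_sum_expMinor_update (y : ℝ) {M : ℕ} (x z : Fin M → ℤ) :
    y * ∑ i, expMinor y (Function.update x i (x i - 1)) z =
      ((∑ i, x i - ∑ i, z i : ℤ) : ℝ) * expMinor y x z := by
  simp only [expMinor, Matrix.det_apply', Matrix.of_apply]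
  rw [Finset.sum_comm, Finset.mul_sum, Finset.mul_sum]
  refine Finset.sum_congr rfl fun σ _ => ?_
  rw [← Finset.mul_sum, mul_left_comm, mul_left_comm _ ((_ : ℤ) : ℝ)]
  congr 1
  have hs : ((∑ i, x i - ∑ i, z i : ℤ) : ℝ) = ∑ i, ((x (σ i) - z i : ℤ) : ℝ) := by
    rw [← Equiv.sum_comp σ x]
    push_cast
    rw [← Finset.sum_sub_distrib]
  rw [hs, ← Equiv.sum_comp σ, Finset.mul_sum, Finset.sum_mul]
  refine Finset.sum_congr rfl fun i _ => ?_
  rw [← Finset.mul_prod_erase _ _ (Finset.mem_univ i),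
    ← Finset.mul_prod_erase _ (fun j => expCoeff y (x (σ j) - z j)) (Finset.mem_univ i),
    ← mul_assoc, ← mul_assoc, intCast_mul_expCoeff, Function.update_self]
  congr 1
  · ring_nf
  · refine Finset.prod_congr rfl fun j hj => ?_
    rw [Function.update_of_ne]
    exact fun h => (Finset.ne_of_mem_erase hj) (σ.injective h)

theorem expMinor_eq_zero_of_lt (y : ℝ) {M : ℕ} {x z : Fin M → ℤ} (hx : Antitone x)
    (hz : Antitone z) {i : Fin M} (hi : x i < z i) : expMinor y x z = 0 := by
  rw [expMinor, Matrix.det_apply']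
  refine Finset.sum_eq_zero fun σ _ => ?_
  obtain ⟨a, ha, hσ⟩ : ∃ a, a ≤ i ∧ i ≤ σ a := by
    by_contra! h
    have hc : (Finset.Iic i).card ≤ (Finset.Iio i).card :=
      Finset.card_le_card_of_injOn σ (fun a ha => by
        simpa using h a (by simpa using ha)) σ.injective.injOn
    simp at hc
  refine mul_eq_zero_of_right _ (Finset.prod_eq_zero (Finset.mem_univ a) ?_)
  rw [Matrix.of_apply]
  apply expCoeff_of_neg
  have h1 := hx hσ
  have h2 := hz ha
  lia

theorem expMinor_self (y : ℝ) {M : ℕ} {x : Fin M → ℤ} (hx : StrictAnti x) :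
    expMinor y x x = 1 := by
  rw [expMinor, Matrix.det_of_isUpperTriangular]
  · simp [expCoeff_zero]
  · intro i j hij
    have : x i < x j := hx hij
    exact expCoeff_of_neg y (by lia)

theorem expMinor_eq_zero_of_eq (y : ℝ) {M : ℕ} {x z : Fin M → ℤ} {i j : Fin M} (hij : i ≠ j)
    (h : x i = x j) : expMinor y x z = 0 :=
  Matrix.det_zero_of_row_eq hij (by ext k; simp [h])

theorem expMinor_eq_zero_of_forall_lt (y : ℝ) {M : ℕ} {x z : Fin M → ℤ} {i : Fin M}
    (h : ∀ j, x i < z j) : expMinor y x z = 0 :=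
  Matrix.det_eq_zero_of_row_eq_zero i fun j => expCoeff_of_neg y (by have := h j; lia)

namespace IntPartition

@[ext]
theorem ext {lam mu : IntPartition} (h : ∀ i, lam.part i = mu.part i) : lam = mu := by
  cases lam; cases mu
  simp only [mk.injEq]
  exact funext h

theorem part_eq_zero_of_le {lam : IntPartition} {M i : ℕ} (hM : lam.part M = 0) (hi : M ≤ i) :
    lam.part i = 0 := Nat.le_zero.mp (hM ▸ lam.antitone hi)

theorem exists_part_eq_zero (lam : IntPartition) : ∃ M, lam.part M = 0 := by
  obtain ⟨M, hM⟩ := lam.finite_supp.exists_notMem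
  exact ⟨M, by simpa using hM⟩

theorem size_eq_sum {lam : IntPartition} {M : ℕ} (hM : lam.part M = 0) :
    lam.size = ∑ i ∈ Finset.range M, lam.part i := by
  refine finsum_eq_sum_of_support_subset _ fun i hi => ?_
  by_contra h
  exact hi (part_eq_zero_of_le hM (by simpa using h))

theorem size_mono {mu lam : IntPartition} (h : ∀ i, mu.part i ≤ lam.part i) :
    mu.size ≤ lam.size := by
  obtain ⟨M, hM⟩ := lam.exists_part_eq_zero
  rw [size_eq_sum hM, size_eq_sum (Nat.le_zero.mp (hM ▸ h M))]
  exact Finset.sum_le_sum fun i _ => h i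

theorem eq_of_le_of_size_eq {mu lam : IntPartition} (h : ∀ i, mu.part i ≤ lam.part i)
    (hs : mu.size = lam.size) : mu = lam := by
  obtain ⟨M, hM⟩ := lam.exists_part_eq_zero
  have hM' : mu.part M = 0 := Nat.le_zero.mp (hM ▸ h M)
  rw [size_eq_sum hM, size_eq_sum hM', Finset.sum_eq_sum_iff_of_le fun i _ => h i] at hs
  ext i
  by_cases hi : i < M
  · exact hs i (by simpa using hi)
  · rw [part_eq_zero_of_le hM (by lia), part_eq_zero_of_le hM' (by lia)]

open scoped Classical in
/-- Remove the last box of row `i`, if this leaves a partition. -/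
noncomputable def removeBox (lam : IntPartition) (i : ℕ) : IntPartition :=
  if h : lam.part (i + 1) < lam.part i then
    { part := Function.update lam.part i (lam.part i - 1)
      antitone := by
        refine antitone_nat_of_succ_le fun n => ?_
        have hn := lam.antitone (Nat.le_succ n)
        simp only [Function.update_apply]
        split_ifs with h1 h2 h2
        · lia
        · subst h1; simp only [Nat.succ_eq_add_one] at hn; lia
        · subst h2; lia
        · exact hn
      finite_supp := by
        refine lam.finite_supp.subset fun n hn => ?_
        simp only [Function.mem_support, Function.update_apply] at hn ⊢
        split_ifs at hn with h1
        · subst h1; lia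
        · exact hn }
  else lam

theorem removeBox_part {lam : IntPartition} {i : ℕ} (h : lam.part (i + 1) < lam.part i) :
    (lam.removeBox i).part = Function.update lam.part i (lam.part i - 1) := by
  simp [removeBox, h]

theorem removeBox_part_le (lam : IntPartition) (i j : ℕ) :
    (lam.removeBox i).part j ≤ lam.part j := by
  by_cases h : lam.part (i + 1) < lam.part i
  · rw [removeBox_part h, Function.update_apply]
    split_ifs with hj
    · subst hj; lia
    · rfl
  · simp [removeBox, h]

theorem size_removeBox {lam : IntPartition} {i : ℕ} (h : lam.part (i + 1) < lam.part i) :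
    lam.size = (lam.removeBox i).size + 1 := by
  obtain ⟨M, hM⟩ := lam.exists_part_eq_zero
  have hi : i < M := by
    by_contra hi
    have := part_eq_zero_of_le hM (not_lt.mp hi)
    lia
  rw [size_eq_sum hM, size_eq_sum (Nat.le_zero.mp (hM ▸ removeBox_part_le lam i M)),
    ← Finset.add_sum_erase _ _ (Finset.mem_range.mpr hi), removeBox_part h,
    ← Finset.add_sum_erase _ _ (Finset.mem_range.mpr hi), Function.update_self]
  have hrest : ∑ j ∈ (Finset.range M).erase i, Function.update lam.part i (lam.part i - 1) j =
      ∑ j ∈ (Finset.range M).erase i, lam.part j :=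
    Finset.sum_congr rfl fun j hj => Function.update_of_ne (Finset.ne_of_mem_erase hj) _ _
  lia

theorem exists_eq_removeBox {nu lam : IntPartition} (h : ∀ i, nu.part i ≤ lam.part i)
    (hs : lam.size = nu.size + 1) :
    ∃ i, lam.part (i + 1) < lam.part i ∧ nu = lam.removeBox i := by
  obtain ⟨i, hi⟩ : ∃ i, nu.part i < lam.part i := by
    by_contra! hc
    have : nu = lam := ext fun i => le_antisymm (h i) (hc i)
    subst this
    lia
  obtain ⟨M, hM⟩ := lam.exists_part_eq_zero
  have hM' : nu.part M = 0 := Nat.le_zero.mp (hM ▸ h M)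
  have hiM : i < M := by
    by_contra hc
    have := part_eq_zero_of_le hM (not_lt.mp hc)
    lia
  rw [size_eq_sum hM, size_eq_sum hM', ← Finset.add_sum_erase _ _ (Finset.mem_range.mpr hiM),
    ← Finset.add_sum_erase _ nu.part (Finset.mem_range.mpr hiM)] at hs
  have hle : ∑ j ∈ (Finset.range M).erase i, nu.part j ≤
    ∑ j ∈ (Finset.range M).erase i, lam.part j := Finset.sum_le_sum fun j _ => h j
  have heq : ∑ j ∈ (Finset.range M).erase i, nu.part j =
    ∑ j ∈ (Finset.range M).erase i, lam.part j := by lia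
  rw [Finset.sum_eq_sum_iff_of_le fun i _ => h i] at heq
  have hne : ∀ j, j ≠ i → nu.part j = lam.part j := by
    intro j hj
    by_cases hjM : j < M
    · exact heq j (by simp [hj, hjM])
    · rw [part_eq_zero_of_le hM (by lia), part_eq_zero_of_le hM' (by lia)]
  have hc : lam.part (i + 1) < lam.part i := by
    rw [← hne (i + 1) (by lia)]
    exact (nu.antitone (Nat.le_succ i)).trans_lt hi
  refine ⟨i, hc, ext fun j => ?_⟩
  rw [removeBox_part hc, Function.update_apply]
  split_ifs with hj
  · subst hj; lia
  · exact hne j hj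

theorem removeBox_injOn (lam : IntPartition) :
    Set.InjOn lam.removeBox {i | lam.part (i + 1) < lam.part i} := by
  intro i hi j hj hij
  by_contra hne
  have := congrFun (congrArg part hij) i
  rw [removeBox_part hi, removeBox_part hj, Function.update_self,
    Function.update_of_ne hne] at this
  simp only [Set.mem_ofPred_eq] at hi
  lia

/-- Saturated chains of length `n` from `mu` to `lam`. -/
def chains (n : ℕ) (mu lam : IntPartition) : Set (ℕ → IntPartition) :=
  {f | f 0 = mu ∧ (∀ k : ℕ, n ≤ k → f k = lam) ∧
    ∀ k : ℕ, k < n →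
      (∀ i : ℕ, (f k).part i ≤ (f (k + 1)).part i) ∧ (f (k + 1)).size = (f k).size + 1}

theorem skewDim_eq_ncard_chains {n : ℕ} {mu lam : IntPartition} (h : lam.size = mu.size + n) :
    skewDim mu lam = (chains n mu lam).ncard := by
  rw [skewDim, chains, h, Nat.add_sub_cancel_left]

theorem chains_zero_self (lam : IntPartition) : chains 0 lam lam = {fun _ => lam} := by
  ext f
  simp only [chains, Set.mem_ofPred_eq, Set.mem_singleton_iff]
  constructor
  · rintro ⟨-, h, -⟩
    exact funext fun k => h k (Nat.zero_le k)
  · rintro rfl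
    simp

theorem chains_zero_of_ne {mu lam : IntPartition} (h : mu ≠ lam) : chains 0 mu lam = ∅ := by
  ext f
  simp only [chains, Set.mem_ofPred_eq, Set.mem_empty_iff_false, iff_false]
  rintro ⟨h0, h1, -⟩
  exact h (h0.symm.trans (h1 0 le_rfl))

/-- Prolong a chain ending at step `n` by one more step to `lam`. -/
def appendChain (n : ℕ) (lam : IntPartition) (f : ℕ → IntPartition) (k : ℕ) : IntPartition :=
  if k ≤ n then f k else lam

theorem appendChain_injOn (n : ℕ) (mu nu lam : IntPartition) :
    Set.InjOn (appendChain n lam) (chains n mu nu) := by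
  intro f hf g hg hfg
  funext k
  by_cases hk : k ≤ n
  · simpa [appendChain, hk] using congrFun hfg k
  · rw [hf.2.1 k (by lia), hg.2.1 k (by lia)]

theorem chains_succ (n : ℕ) (mu lam : IntPartition) :
    chains (n + 1) mu lam = ⋃ i ∈ {i | lam.part (i + 1) < lam.part i},
      appendChain n lam '' chains n mu (lam.removeBox i) := by
  ext f
  simp only [Set.mem_iUnion, Set.mem_image, Set.mem_ofPred_eq, exists_prop]
  constructor
  · rintro ⟨h0, h1, h2⟩
    obtain ⟨hle, hs⟩ := h2 n (Nat.lt_succ_self n)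
    rw [h1 (n + 1) le_rfl] at hle hs
    obtain ⟨i, hi, hfi⟩ := exists_eq_removeBox hle hs
    refine ⟨i, hi, fun k => if k ≤ n then f k else f n, ⟨by simpa using h0, ?_, ?_⟩, ?_⟩
    · intro k hk
      dsimp only
      split_ifs with hkn
      · rw [le_antisymm hkn hk, hfi]
      · exact hfi
    · intro k hk
      simpa [hk.le, Nat.succ_le_of_lt hk] using h2 k (by lia)
    · funext k
      simp only [appendChain]
      split_ifs with hk
      · rfl
      · exact (h1 k (by lia)).symm
  · rintro ⟨i, hi, g, ⟨h0, h1, h2⟩, rfl⟩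
    refine ⟨by simpa [appendChain] using h0, fun k hk => by
      simp [appendChain, show ¬ k ≤ n by lia], fun k hk => ?_⟩
    rcases Nat.lt_succ_iff_lt_or_eq.mp hk with hk | rfl
    · simpa [appendChain, hk.le, Nat.succ_le_of_lt hk] using h2 k hk
    · simp only [appendChain, le_refl, if_true, show ¬ k + 1 ≤ k by lia, if_false, h1 k le_rfl]
      exact ⟨removeBox_part_le lam i, size_removeBox hi⟩

theorem corners_finite (lam : IntPartition) : {i | lam.part (i + 1) < lam.part i}.Finite :=
  lam.finite_supp.subset fun i hi => by
    simp only [Set.mem_ofPred_eq] at hi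
    simp only [Function.mem_support]
    lia

theorem chains_finite (n : ℕ) (mu lam : IntPartition) : (chains n mu lam).Finite := by
  induction n generalizing lam with
  | zero =>
    by_cases h : mu = lam
    · subst h; rw [chains_zero_self]; exact Set.finite_singleton _
    · rw [chains_zero_of_ne h]; exact Set.finite_empty
  | succ n ih =>
    rw [chains_succ]
    exact lam.corners_finite.biUnion fun i _ => (ih _).image _

theorem ncard_chains_succ (n : ℕ) (mu lam : IntPartition) {M : ℕ} (hM : lam.part M = 0) :
    (chains (n + 1) mu lam).ncard = ∑ i ∈ Finset.range M with lam.part (i + 1) < lam.part i,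
      (chains n mu (lam.removeBox i)).ncard := by
  rw [chains_succ, lam.corners_finite.ncard_biUnion]
  · rw [finsum_mem_eq_sum_of_inter_support_eq _ (t := {i ∈ Finset.range M |
      lam.part (i + 1) < lam.part i})]
    · exact Finset.sum_congr rfl fun i _ => (appendChain_injOn _ _ _ _).ncard_image
    · congr 1
      ext i
      simp only [Set.mem_ofPred_eq, Finset.coe_filter, Finset.mem_range, iff_and_self]
      intro hi
      by_contra hc
      have := part_eq_zero_of_le hM (not_lt.mp hc)
      lia
  · exact fun i _ => (chains_finite _ _ _).image _
  · intro i hi j hj hij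
    refine Set.disjoint_left.mpr ?_
    rintro _ ⟨f, hf, rfl⟩ ⟨g, hg, hgf⟩
    refine hij (lam.removeBox_injOn hi hj ?_)
    have := congrFun hgf n
    simp only [appendChain, le_refl, if_true] at this
    rw [← hf.2.1 n le_rfl, ← hg.2.1 n le_rfl, this]

/-- The strictly decreasing sequence `lam_i - i` for the first `M` rows. -/
def shifted (M : ℕ) (lam : IntPartition) (i : Fin M) : ℤ := (lam.part i : ℤ) - (i : ℕ)

theorem shifted_strictAnti (M : ℕ) (lam : IntPartition) : StrictAnti (lam.shifted M) := by
  intro i j hij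
  have := lam.antitone hij.le
  have h2 : (i : ℕ) < j := hij
  simp only [shifted]
  have : lam.part j ≤ lam.part i := lam.antitone h2.le
  lia

theorem sum_shifted {M : ℕ} {lam : IntPartition} (hM : lam.part M = 0) :
    ∑ i, lam.shifted M i = (lam.size : ℤ) - ∑ i : Fin M, ((i : ℕ) : ℤ) := by
  simp only [shifted, Finset.sum_sub_distrib, size_eq_sum hM, Finset.sum_range]
  push_cast
  rfl

theorem shifted_removeBox {M : ℕ} {lam : IntPartition} {i : Fin M}
    (hi : lam.part (i + 1) < lam.part i) :
    (lam.removeBox i).shifted M = Function.update (lam.shifted M) i (lam.shifted M i - 1) := by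
  funext j
  simp only [shifted, removeBox_part hi, Function.update_apply]
  by_cases hij : j = i
  · subst hij; simp only [if_true]; lia
  · simp [hij, Fin.val_inj]

theorem expMinor_update_eq_zero (y : ℝ) {M : ℕ} {mu lam : IntPartition} (hM : lam.part M = 0)
    {i : Fin M} (hi : ¬ lam.part (i + 1) < lam.part i) :
    expMinor y (Function.update (lam.shifted M) i (lam.shifted M i - 1)) (mu.shifted M) = 0 := by
  have heq : lam.part (i + 1) = lam.part i := le_antisymm (lam.antitone (Nat.le_succ _))
    (not_lt.mp hi)
  by_cases hlt : (i : ℕ) + 1 < M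
  · refine expMinor_eq_zero_of_eq y (i := i) (j := ⟨i + 1, hlt⟩)
      (by simp [Fin.ext_iff]) ?_
    rw [Function.update_self, Function.update_of_ne (by simp [Fin.ext_iff])]
    simp only [shifted, heq]
    push_cast
    ring
  · refine expMinor_eq_zero_of_forall_lt y (i := i) fun j => ?_
    have hiM : (i : ℕ) + 1 = M := by have := i.2; lia
    rw [hiM, hM] at heq
    have := j.2
    rw [Function.update_self]
    simp only [shifted, ← heq]
    lia

/-- The determinantal formula for the number of standard tableaux of a skew shape. -/
theorem expMinor_shifted (y : ℝ) {M : ℕ} {mu : IntPartition} (hmu : mu.part M = 0) (n : ℕ)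
    (lam : IntPartition) (hlam : lam.part M = 0) (hs : lam.size = mu.size + n) :
    expMinor y (lam.shifted M) (mu.shifted M) =
      (chains n mu lam).ncard * y ^ n / n.factorial := by
  induction n generalizing lam with
  | zero =>
    by_cases h : mu = lam
    · subst h
      simp [chains_zero_self, expMinor_self y (mu.shifted_strictAnti M)]
    · rw [chains_zero_of_ne h]
      obtain ⟨i, hi⟩ : ∃ i, lam.part i < mu.part i := by
        by_contra! hc
        exact h (eq_of_le_of_size_eq hc (by lia))
      have hiM : i < M := by
        by_contra hc
        have := part_eq_zero_of_le hmu (not_lt.mp hc)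
        lia
      rw [expMinor_eq_zero_of_lt y (lam.shifted_strictAnti M).antitone
        (mu.shifted_strictAnti M).antitone (i := ⟨i, hiM⟩) (by simp [shifted]; lia)]
      simp
  | succ n ih =>
    have key := mul_sum_expMinor_update y (lam.shifted M) (mu.shifted M)
    have hsum : ∑ i, expMinor y (Function.update (lam.shifted M) i (lam.shifted M i - 1))
        (mu.shifted M) = (chains (n + 1) mu lam).ncard * y ^ n / n.factorial := by
      rw [ncard_chains_succ n mu lam hlam, Finset.sum_filter, Finset.sum_range]
      push_cast
      rw [Finset.sum_mul, Finset.sum_div]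
      refine Finset.sum_congr rfl fun i _ => ?_
      split_ifs with hi
      · rw [← shifted_removeBox hi]
        refine ih _ (Nat.le_zero.mp (hlam ▸ removeBox_part_le lam i M)) ?_
        have := size_removeBox hi
        lia
      · rw [expMinor_update_eq_zero y hlam hi]; simp
    rw [hsum, sum_shifted hlam, sum_shifted hmu, hs] at key
    have hn : (n.factorial : ℝ) ≠ 0 := by positivity
    have hn1 : (n : ℝ) + 1 ≠ 0 := by positivity
    rw [Nat.factorial_succ]
    push_cast at key ⊢
    field_simp at key ⊢
    linear_combination -key

theorem expMinor_shifted_of_le (y : ℝ) {M : ℕ} {mu lam : IntPartition} (hlam : lam.part M = 0)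
    (h : ∀ i, mu.part i ≤ lam.part i) :
    expMinor y (lam.shifted M) (mu.shifted M) =
      skewDim mu lam * y ^ (lam.size - mu.size) / (lam.size - mu.size).factorial := by
  have hs : lam.size = mu.size + (lam.size - mu.size) := by have := size_mono h; lia
  rw [skewDim_eq_ncard_chains hs]
  exact expMinor_shifted y (Nat.le_zero.mp (hlam ▸ h M)) _ lam hlam hs

theorem expMinor_shifted_of_not_le (y : ℝ) {M : ℕ} {mu lam : IntPartition} (hmu : mu.part M = 0)
    (h : ¬ ∀ i, mu.part i ≤ lam.part i) :
    expMinor y (lam.shifted M) (mu.shifted M) = 0 := by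
  push Not at h
  obtain ⟨i, hi⟩ := h
  have hiM : i < M := by
    by_contra hc
    have := part_eq_zero_of_le hmu (not_lt.mp hc)
    lia
  exact expMinor_eq_zero_of_lt y (lam.shifted_strictAnti M).antitone
    (mu.shifted_strictAnti M).antitone (i := ⟨i, hiM⟩) (by simp [shifted]; lia)

end IntPartition

open Matrix in
theorem coeff_det_one_add_X_smul_eq_sum_orderEmb {L : ℕ} (A : Matrix (Fin L) (Fin L) ℝ) (k : ℕ) :
    (det (1 + (Polynomial.X : Polynomial ℝ) • A.map Polynomial.C)).coeff k =
      ∑ e : Fin k ↪o Fin L, (A.submatrix e e).det := by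
  rw [coeff_det_one_add_X_smul_eq_sum_minors]
  refine Finset.sum_bij' (fun s hs => s.orderEmbOfFin (Finset.mem_powersetCard.mp hs).2)
    (fun e _ => Finset.univ.map e.toEmbedding) (fun _ _ => Finset.mem_univ _)
    (fun e _ => by simp [Finset.mem_powersetCard]) (fun s hs => ?_) (fun e _ => ?_)
    (fun s hs => ?_)
  · rw [← Finset.coe_inj, ← Finset.range_orderEmbOfFin s (Finset.mem_powersetCard.mp hs).2]
    simp
  · symm
    exact Finset.orderEmbOfFin_unique' _ (by simp)
  · rw [← det_submatrix_equiv_self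
      (s.orderIsoOfFin (Finset.mem_powersetCard.mp hs).2).toEquiv, submatrix_submatrix]
    rfl

open Matrix in
/-- The Cauchy–Binet formula. -/
theorem det_mul_eq_sum_orderEmb {L M : ℕ} (P : Matrix (Fin M) (Fin L) ℝ)
    (R : Matrix (Fin L) (Fin M) ℝ) :
    (P * R).det = ∑ e : Fin M ↪o Fin L, (P.submatrix id e).det * (R.submatrix e id).det := by
  have h1 := coeff_det_one_add_X_smul_eq_sum_orderEmb (R * P) M
  have h2 := coeff_det_one_add_X_smul_eq_sum_orderEmb (P * R) M
  have heq : ∀ e : Fin M ↪o Fin M, e = (OrderIso.refl (Fin M)).toOrderEmbedding := fun e => by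
    have h : (Finset.univ : Finset (Fin M)).card = M := by simp
    rw [Finset.orderEmbOfFin_unique' h (f := e) (by simp)]
    exact (Finset.orderEmbOfFin_unique' h (by simp)).symm
  have hid : ∀ e : Fin M ↪o Fin M, (e : Fin M → Fin M) = id := fun e => by
    rw [heq e]
    rfl
  have : Unique (Fin M ↪o Fin M) := ⟨⟨(OrderIso.refl (Fin M)).toOrderEmbedding⟩, heq⟩
  rw [Fintype.sum_unique, hid, submatrix_id_id] at h2
  rw [← h2, Matrix.map_mul, ← Matrix.smul_mul, det_one_add_mul_comm, Matrix.mul_smul,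
    ← Matrix.map_mul, h1]
  refine Finset.sum_congr rfl fun e _ => ?_
  rw [mul_comm, ← det_mul]
  rfl

theorem OrderEmbedding.val_le_val_apply {k L : ℕ} (e : Fin k ↪o Fin L) (i : Fin k) :
    (i : ℕ) ≤ e i := by
  obtain ⟨i, hi⟩ := i
  induction i with
  | zero => exact Nat.zero_le _
  | succ i ih =>
    have h : e ⟨i, by lia⟩ < e ⟨i + 1, hi⟩ := e.strictMono (by simp)
    exact (ih (by lia)).trans_lt h

/-- The lower triangular Toeplitz matrix of `exp (y * u)`. -/
noncomputable def expMatrix (y : ℝ) (L : ℕ) : Matrix (Fin L) (Fin L) ℝ :=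
  Matrix.of fun a n => expCoeff y ((a : ℕ) - (n : ℕ))

/-- The one-particle transfer matrix of the cylindric Plancherel measure. -/
noncomputable def cylMatrix (q y : ℝ) (L : ℕ) : Matrix (Fin L) (Fin L) ℝ :=
  expMatrix y L * Matrix.diagonal (fun n : Fin L => q ^ (n : ℕ)) * (expMatrix y L).transpose

open Matrix in
theorem det_submatrix_cylMatrix (q y : ℝ) {L M : ℕ} (e : Fin M ↪o Fin L) :
    ((cylMatrix q y L).submatrix e e).det = ∑ f : Fin M ↪o Fin L,
      (∏ i, q ^ (f i : ℕ)) * ((expMatrix y L).submatrix e f).det ^ 2 := by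
  have h : (cylMatrix q y L).submatrix e e =
      ((expMatrix y L).submatrix e id * diagonal (fun n : Fin L => q ^ (n : ℕ))) *
        ((expMatrix y L).submatrix e id).transpose := by
    rw [cylMatrix]
    rfl
  rw [h, det_mul_eq_sum_orderEmb]
  refine Finset.sum_congr rfl fun f _ => ?_
  have h1 : ((expMatrix y L).submatrix e id * diagonal (fun n : Fin L => q ^ (n : ℕ))).submatrix
      id f = of fun i j => q ^ (f j : ℕ) * (expMatrix y L).submatrix e f i j := by
    ext i j
    simp [mul_comm]
  have h2 : (((expMatrix y L).submatrix e id).transpose.submatrix f id) =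
      ((expMatrix y L).submatrix e f).transpose := rfl
  rw [h1, det_mul_row, h2, det_transpose]
  ring

namespace IntPartition

open scoped Classical in
/-- The total cylindric Plancherel weight of the partitions in the `M × N` box. -/
noncomputable def boxSum (q y : ℝ) (M N : ℕ) : ℝ :=
  ∑' lam : IntPartition,
    if lam.part M = 0 ∧ lam.part 0 ≤ N then cpmWeight q y lam else 0

/-- Partitions in the `M × N` box correspond to `M`-particle configurations on `M + N` sites. -/
noncomputable def boxEquiv (M N : ℕ) :
    {lam : IntPartition // lam.part M = 0 ∧ lam.part 0 ≤ N} ≃ (Fin M ↪o Fin (M + N)) where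
  toFun lam := OrderEmbedding.ofStrictMono
    (fun i => ⟨lam.1.part i.rev + i, by
      have := lam.1.antitone (Nat.zero_le (i.rev : ℕ))
      have := lam.2.2
      have := i.2
      lia⟩)
    (fun i j hij => by
      have h : (j.rev : ℕ) ≤ i.rev := by simp only [Fin.val_rev]; have : (i : ℕ) < j := hij; lia
      have := lam.1.antitone h
      have : (i : ℕ) < j := hij
      simp only [Fin.mk_lt_mk]
      lia)
  invFun e :=
    ⟨{ part := fun j => if h : j < M then (e (Fin.rev ⟨j, h⟩) : ℕ) - (Fin.rev ⟨j, h⟩ : Fin M) else 0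
       antitone := by
        refine antitone_nat_of_succ_le fun j => ?_
        by_cases h1 : j + 1 < M
        · have h0 : j < M := by lia
          have hlt : (Fin.rev ⟨j + 1, h1⟩ : Fin M) < Fin.rev ⟨j, h0⟩ := by
            simp
          have := e.strictMono hlt
          have h3 : (e (Fin.rev ⟨j + 1, h1⟩) : ℕ) < e (Fin.rev ⟨j, h0⟩) := this
          simp only [h1, h0, dif_pos, Fin.val_rev]
          lia
        · simp [h1]
       finite_supp := (Finset.range M).finite_toSet.subset fun j hj => by
        simp only [Function.mem_support] at hj
        by_contra hc
        simp only [Finset.coe_range, Set.mem_Iio] at hc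
        simp [hc] at hj },
      by simp, by
        dsimp only
        split_ifs with h
        · have := (e (Fin.rev ⟨0, h⟩)).2
          simp only [Fin.val_rev]
          lia
        · lia⟩
  left_inv := by
    rintro ⟨lam, h1, h2⟩
    ext j
    dsimp only
    split_ifs with h
    · simp [show M - (M - (j + 1) + 1) = j by lia]
    · exact (part_eq_zero_of_le h1 (by lia)).symm
  right_inv := by
    intro e
    ext i
    have hge := e.val_le_val_apply i
    simp only [OrderEmbedding.coe_ofStrictMono, Fin.is_lt, dif_pos, Fin.eta, Fin.rev_rev]
    lia

theorem part_boxEquiv_symm {M N : ℕ} (e : Fin M ↪o Fin (M + N)) (i : Fin M) :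
    (((boxEquiv M N).symm e).1.part i : ℤ) = (e i.rev : ℕ) - (i.rev : ℕ) := by
  have := e.val_le_val_apply i.rev
  simp only [boxEquiv, Equiv.coe_fn_symm_mk, Fin.is_lt, dif_pos, Fin.eta]
  lia

theorem shifted_boxEquiv_symm {M N : ℕ} (e : Fin M ↪o Fin (M + N)) (i : Fin M) :
    ((boxEquiv M N).symm e).1.shifted M i = (e i.rev : ℕ) - ((M : ℤ) - 1) := by
  have := i.2
  rw [shifted, part_boxEquiv_symm, Fin.val_rev]
  lia

theorem expMinor_shifted_boxEquiv_symm (y : ℝ) {M N : ℕ} (e f : Fin M ↪o Fin (M + N)) :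
    expMinor y (((boxEquiv M N).symm e).1.shifted M) (((boxEquiv M N).symm f).1.shifted M) =
      ((expMatrix y (M + N)).submatrix e f).det := by
  rw [← Matrix.det_submatrix_equiv_self Fin.revPerm, expMinor]
  congr 1
  ext i j
  simp [shifted_boxEquiv_symm, expMatrix]

theorem size_boxEquiv_symm {M N : ℕ} (e : Fin M ↪o Fin (M + N)) :
    ((boxEquiv M N).symm e).1.size + ∑ i ∈ Finset.range M, i = ∑ i, (e i : ℕ) := by
  zify
  rw [size_eq_sum ((boxEquiv M N).symm e).2.1, Finset.sum_range, Finset.sum_range,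
    ← Equiv.sum_comp Fin.revPerm (fun i => ((e i : ℕ) : ℤ)),
    ← Equiv.sum_comp Fin.revPerm (fun i : Fin M => ((i : ℕ) : ℤ))]
  push_cast
  rw [← Finset.sum_add_distrib]
  refine Finset.sum_congr rfl fun i _ => ?_
  rw [part_boxEquiv_symm]
  simp

theorem tsum_box {M N : ℕ} (f : IntPartition → ℝ)
    (hf : ∀ lam, ¬ (lam.part M = 0 ∧ lam.part 0 ≤ N) → f lam = 0) :
    ∑' lam, f lam = ∑ e : Fin M ↪o Fin (M + N), f ((boxEquiv M N).symm e).1 := by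
  rw [← tsum_fintype (L := .unconditional _), (boxEquiv M N).symm.tsum_eq (fun lam => f lam.1)]
  symm
  refine tsum_subtype_eq_of_support_subset
    (s := {lam : IntPartition | lam.part M = 0 ∧ lam.part 0 ≤ N})
    fun lam hlam => ?_
  by_contra hc
  exact hlam (hf lam hc)

theorem cpmWeight_boxEquiv_symm (q y : ℝ) {M N : ℕ} (e : Fin M ↪o Fin (M + N)) :
    q ^ (∑ i ∈ Finset.range M, i) * cpmWeight q y ((boxEquiv M N).symm e).1 =
      ((cylMatrix q y (M + N)).submatrix e e).det := by
  classical
  set lam := (boxEquiv M N).symm e with hlam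
  rw [det_submatrix_cylMatrix, cpmWeight, tsum_box (M := M) (N := N), Finset.mul_sum]
  · refine Finset.sum_congr rfl fun f _ => ?_
    rw [Finset.prod_pow_eq_pow_sum, ← size_boxEquiv_symm f, pow_add,
      ← expMinor_shifted_boxEquiv_symm, ← hlam]
    split_ifs with h
    · rw [expMinor_shifted_of_le y lam.2.1 h]
      ring
    · rw [expMinor_shifted_of_not_le y ((boxEquiv M N).symm f).2.1 h]
      simp
  · intro mu hmu
    rw [if_neg]
    intro h
    exact hmu ⟨Nat.le_zero.mp (lam.2.1 ▸ h M), (h 0).trans lam.2.2⟩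

theorem pow_mul_boxSum (q y : ℝ) (M N : ℕ) :
    q ^ (∑ i ∈ Finset.range M, i) * boxSum q y M N =
      ∑ e : Fin M ↪o Fin (M + N), ((cylMatrix q y (M + N)).submatrix e e).det := by
  classical
  rw [boxSum, tsum_box (M := M) (N := N) _ fun lam h => if_neg h, Finset.mul_sum]
  refine Finset.sum_congr rfl fun e _ => ?_
  rw [if_pos ((boxEquiv M N).symm e).2, cpmWeight_boxEquiv_symm]

end IntPartition

open Matrix in
/-- The grand canonical partition function of `cylMatrix`. -/
theorem det_one_add_smul_cylMatrix (q y z : ℝ) (L : ℕ) :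
    det (1 + z • cylMatrix q y L) = ∑ k ∈ Finset.range (L + 1),
      z ^ k * (q ^ (∑ i ∈ Finset.range k, i) * IntPartition.boxSum q y k (L - k)) := by
  set p := det (1 + (Polynomial.X : Polynomial ℝ) • (cylMatrix q y L).map Polynomial.C) with hp
  have heval : det (1 + z • cylMatrix q y L) = p.eval z := by
    rw [hp, ← Polynomial.coe_evalRingHom, RingHom.map_det]
    congr 1
    ext i j
    simp [Matrix.one_apply, apply_ite]
    exact mul_comm _ _
  have hcoeff : ∀ k ≤ L, p.coeff k =
      q ^ (∑ i ∈ Finset.range k, i) * IntPartition.boxSum q y k (L - k) := by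
    intro k hk
    obtain ⟨N, rfl⟩ := Nat.exists_eq_add_of_le hk
    rw [hp, coeff_det_one_add_X_smul_eq_sum_orderEmb, Nat.add_sub_cancel_left,
      IntPartition.pow_mul_boxSum]
  have hdeg : p.natDegree < L + 1 := by
    rw [Nat.lt_succ_iff, Polynomial.natDegree_le_iff_coeff_eq_zero]
    intro k hk
    rw [hp, coeff_det_one_add_X_smul_eq_sum_orderEmb]
    refine Finset.sum_eq_zero fun e _ => ?_
    have := Fintype.card_le_of_injective e e.injective
    simp at this
    lia
  rw [heval, Polynomial.eval_eq_sum_range' hdeg]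
  refine Finset.sum_congr rfl fun k hk => ?_
  rw [hcoeff k (by simpa [Nat.lt_succ_iff] using hk)]
  ring

namespace IntPartition

/-- The conjugate partition. -/
noncomputable def conj (lam : IntPartition) : IntPartition :=
  have hex : ∀ j, ∃ i, lam.part i ≤ j := fun j => by
    obtain ⟨M, hM⟩ := lam.exists_part_eq_zero
    exact ⟨M, by lia⟩
  { part := fun j => sInf {i | lam.part i ≤ j}
    antitone := fun j k hjk => csInf_le_csInf' (hex j) fun _ hi => le_trans hi hjk
    finite_supp := (Finset.range (lam.part 0)).finite_toSet.subset fun j hj => by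
      by_contra hc
      have h0 : 0 ∈ {i | lam.part i ≤ j} := by simpa using hc
      exact hj (Nat.le_zero.mp (Nat.sInf_le h0)) }

theorem lt_conj_part {lam : IntPartition} {i j : ℕ} : i < lam.conj.part j ↔ j < lam.part i := by
  obtain ⟨M, hM⟩ := lam.exists_part_eq_zero
  have hmem : lam.part (sInf {i | lam.part i ≤ j}) ≤ j :=
    Nat.sInf_mem (s := {i | lam.part i ≤ j}) ⟨M, by simp [hM]⟩
  constructor
  · intro h
    by_contra hc
    exact absurd (Nat.sInf_le (s := {i | lam.part i ≤ j}) (m := i) (by simpa using hc))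
      (not_le.mpr h)
  · intro h
    by_contra hc
    have := lam.antitone (not_lt.mp hc : lam.conj.part j ≤ i)
    exact absurd (this.trans hmem) (not_le.mpr h)

theorem conj_conj (lam : IntPartition) : lam.conj.conj = lam :=
  ext fun i => eq_of_forall_lt_iff fun j => by rw [lt_conj_part, lt_conj_part]

theorem conj_part_le_iff {mu lam : IntPartition} :
    (∀ i, mu.conj.part i ≤ lam.conj.part i) ↔ ∀ i, mu.part i ≤ lam.part i := by
  have h : ∀ mu lam : IntPartition, (∀ i, mu.part i ≤ lam.part i) →
      ∀ i, mu.conj.part i ≤ lam.conj.part i := fun mu lam h i => forall_lt_iff_le.mp fun j hj =>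
    lt_conj_part.mpr ((lt_conj_part.mp hj).trans_le (h j))
  exact ⟨fun hc => by simpa only [conj_conj] using h _ _ hc, h mu lam⟩

theorem size_eq_sum_sum {lam : IntPartition} {M N : ℕ} (hM : lam.part M = 0)
    (hN : lam.part 0 ≤ N) :
    lam.size = ∑ i ∈ Finset.range M, ∑ j ∈ Finset.range N, if j < lam.part i then 1 else 0 := by
  rw [size_eq_sum hM]
  refine Finset.sum_congr rfl fun i _ => ?_
  have hi := (lam.antitone (Nat.zero_le i)).trans hN
  rw [← Finset.sum_filter, ← Finset.card_eq_sum_ones]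
  convert (Finset.card_range (lam.part i)).symm using 2
  ext j
  simp only [Finset.mem_filter, Finset.mem_range]
  lia

theorem conj_part_eq_zero_iff {lam : IntPartition} {N : ℕ} :
    lam.conj.part N = 0 ↔ lam.part 0 ≤ N := by
  rw [← not_lt, ← lt_conj_part, not_lt, Nat.le_zero]

theorem conj_part_zero_le_iff {lam : IntPartition} {M : ℕ} :
    lam.conj.part 0 ≤ M ↔ lam.part M = 0 := by
  rw [← conj_part_eq_zero_iff, conj_conj]

theorem size_conj (lam : IntPartition) : lam.conj.size = lam.size := by
  obtain ⟨M, hM⟩ := lam.exists_part_eq_zero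
  rw [size_eq_sum_sum hM le_rfl, size_eq_sum_sum (conj_part_eq_zero_iff.mpr le_rfl)
    (conj_part_zero_le_iff.mpr hM), Finset.sum_comm]
  simp only [lt_conj_part]

/-- Conjugation as an involution. -/
noncomputable def conjEquiv : IntPartition ≃ IntPartition :=
  ⟨conj, conj, conj_conj, conj_conj⟩

theorem skewDim_conj (mu lam : IntPartition) : skewDim mu.conj lam.conj = skewDim mu lam := by
  rw [skewDim, skewDim, size_conj, size_conj]
  symm
  refine Set.ncard_congr (fun f _ k => (f k).conj) ?_ ?_ ?_
  · rintro f ⟨h0, h1, h2⟩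
    refine ⟨by simp [h0], fun k hk => by simp [h1 k hk], fun k hk => ?_⟩
    simpa only [conj_part_le_iff, size_conj] using h2 k hk
  · intro f g _ _ h
    funext k
    exact conjEquiv.injective (congrFun h k)
  · rintro f ⟨h0, h1, h2⟩
    refine ⟨fun k => (f k).conj, ⟨by simp [h0, conj_conj], fun k hk => by
      simp [h1 k hk, conj_conj], fun k hk => ?_⟩, by simp [conj_conj]⟩
    simpa only [conj_part_le_iff, size_conj] using h2 k hk

theorem cpmWeight_conj (q y : ℝ) (lam : IntPartition) :
    cpmWeight q y lam.conj = cpmWeight q y lam := by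
  classical
  rw [cpmWeight, cpmWeight, ← conjEquiv.tsum_eq]
  refine tsum_congr fun mu => ?_
  simp only [conjEquiv, Equiv.coe_fn_mk, size_conj, skewDim_conj]
  exact if_congr conj_part_le_iff rfl rfl

theorem boxSum_comm (q y : ℝ) (M N : ℕ) : boxSum q y M N = boxSum q y N M := by
  rw [boxSum, boxSum, ← conjEquiv.tsum_eq]
  refine tsum_congr fun lam => ?_
  simp only [conjEquiv, Equiv.coe_fn_mk, conj_part_eq_zero_iff, conj_part_zero_le_iff,
    cpmWeight_conj, and_comm]

end IntPartition

section

open Matrix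

theorem expCoeff_nonneg {y : ℝ} (hy : 0 ≤ y) (k : ℤ) : 0 ≤ expCoeff y k := by
  unfold expCoeff
  split_ifs <;> positivity

theorem abs_expCoeff_neg {y : ℝ} (hy : 0 ≤ y) (k : ℤ) : |expCoeff (-y) k| = expCoeff y k := by
  unfold expCoeff
  split_ifs
  · simp
  · rw [abs_div, abs_pow, abs_neg, abs_of_nonneg hy, Nat.abs_cast]

theorem pow_mul_expCoeff (t y : ℝ) (n : ℕ) : t ^ n * expCoeff y n = expCoeff (t * y) n := by
  rw [expCoeff_natCast, expCoeff_natCast, mul_pow, mul_div_assoc]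

theorem sum_expCoeff_le_exp {y : ℝ} (hy : 0 ≤ y) (L : ℕ) :
    ∑ n ∈ Finset.range L, expCoeff y n ≤ Real.exp y := by
  simpa only [expCoeff_natCast] using Real.sum_le_exp_of_nonneg hy L

theorem sum_expCoeff_mul_expCoeff_neg (y : ℝ) (m : ℕ) :
    ∑ p ∈ Finset.HasAntidiagonal.antidiagonal m, expCoeff y p.1 * expCoeff (-y) p.2 =
      if m = 0 then 1 else 0 := by
  have h := Finset.sum_congr rfl fun p (hp : p ∈ Finset.HasAntidiagonal.antidiagonal m) =>
    show (m.factorial : ℝ) * (expCoeff y p.1 * expCoeff (-y) p.2) =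
      (m.choose p.1 : ℝ) * (y ^ p.1 * (-y) ^ p.2) by
    rw [Finset.HasAntidiagonal.mem_antidiagonal] at hp
    subst hp
    rw [expCoeff_natCast, expCoeff_natCast, ← Nat.choose_mul_factorial_mul_factorial
      (Nat.le_add_right p.1 p.2), Nat.add_sub_cancel_left]
    push_cast
    field_simp
  have h2 := (Commute.all y (-y)).add_pow' m
  simp only [nsmul_eq_mul] at h2
  rw [← h2, ← Finset.mul_sum] at h
  split_ifs with hm
  · subst hm; simp [expCoeff_zero]
  · rw [add_neg_cancel, zero_pow hm, mul_eq_zero] at h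
    exact h.resolve_left (by positivity)

theorem expMatrix_mul_expMatrix_neg (y : ℝ) (L : ℕ) : expMatrix y L * expMatrix (-y) L = 1 := by
  ext i j
  rw [mul_apply, one_apply]
  simp only [expMatrix, of_apply]
  rw [Fin.sum_univ_eq_sum_range
    (fun n => expCoeff y ((i : ℕ) - (n : ℕ)) * expCoeff (-y) ((n : ℕ) - (j : ℕ)))]
  by_cases hij : (j : ℕ) ≤ i
  · obtain ⟨m, hm⟩ := Nat.exists_eq_add_of_le hij
    have h := sum_expCoeff_mul_expCoeff_neg y m
    have hi := i.2
    rw [Finset.Nat.sum_antidiagonal_eq_sum_range_succ_mk, ← Finset.sum_range_reflect] at h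
    rw [show (if i = j then (1 : ℝ) else 0) = if m = 0 then 1 else 0 by
      simp only [Fin.ext_iff, hm]; congr 1; simp, ← h,
      ← Finset.sum_subset (s₁ := Finset.Ico (j : ℕ) (j + (m + 1))), Finset.sum_Ico_eq_sum_range]
    · rw [Nat.add_sub_cancel_left]
      refine Finset.sum_congr rfl fun k hk => ?_
      rw [Finset.mem_range] at hk
      congr 2 <;> lia
    · intro n hn
      simp only [Finset.mem_Ico, Finset.mem_range] at hn ⊢
      lia
    · intro n _ hn
      simp only [Finset.mem_Ico, not_and_or, not_le, not_lt] at hn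
      rcases hn with hn | hn
      · rw [expCoeff_of_neg (-y) (by lia), mul_zero]
      · rw [expCoeff_of_neg y (by lia), zero_mul]
  · rw [if_neg (by rintro rfl; simp at hij)]
    refine Finset.sum_eq_zero fun n _ => ?_
    rcases lt_or_ge n (j : ℕ) with hn | hn
    · rw [expCoeff_of_neg (-y) (by lia), mul_zero]
    · rw [expCoeff_of_neg y (by lia), zero_mul]

theorem posSemidef_cylMatrix {q : ℝ} (hq : 0 ≤ q) (y : ℝ) (L : ℕ) :
    (cylMatrix q y L).PosSemidef := by
  have h : (diagonal (fun n : Fin L => q ^ (n : ℕ))).PosSemidef :=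
    PosSemidef.diagonal fun n => pow_nonneg hq _
  rw [cylMatrix, ← conjTranspose_eq_transpose_of_trivial]
  exact h.mul_mul_conjTranspose_same (expMatrix y L)

theorem posDef_one_add_smul_cylMatrix {q z : ℝ} (hq : 0 ≤ q) (hz : 0 ≤ z) (y : ℝ) (L : ℕ) :
    (1 + z • cylMatrix q y L).PosDef :=
  PosDef.one.add_posSemidef ((posSemidef_cylMatrix hq y L).smul hz)

theorem det_one_add_smul_cylMatrix_pos {q z : ℝ} (hq : 0 ≤ q) (hz : 0 ≤ z) (y : ℝ) (L : ℕ) :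
    0 < det (1 + z • cylMatrix q y L) :=
  (posDef_one_add_smul_cylMatrix hq hz y L).det_pos

theorem cylMatrix_apply (q y : ℝ) {L : ℕ} (i j : Fin L) :
    cylMatrix q y L i j = ∑ n : Fin L,
      expCoeff y ((i : ℕ) - (n : ℕ)) * q ^ (n : ℕ) * expCoeff y ((j : ℕ) - (n : ℕ)) := by
  rw [cylMatrix, mul_apply]
  simp [mul_diagonal, expMatrix]

theorem cylMatrix_zero_left (q y : ℝ) {L : ℕ} (j : Fin (L + 1)) :
    cylMatrix q y (L + 1) 0 j = expCoeff y (j : ℕ) := by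
  rw [cylMatrix_apply, Fin.sum_univ_succ, Finset.sum_eq_zero]
  · simp [expCoeff_zero]
  · intro n _
    rw [expCoeff_of_neg y (by simp; lia), zero_mul, zero_mul]

theorem cylMatrix_succ (q y : ℝ) {L : ℕ} (i : Fin L) (j : Fin (L + 1)) :
    cylMatrix q y (L + 1) i.succ j = expCoeff y (i.succ : ℕ) * expCoeff y (j : ℕ) +
      Fin.cases 0 (fun j => q * cylMatrix q y L i j) j := by
  rw [cylMatrix_apply, Fin.sum_univ_succ]
  congr 1
  · simp
  · refine Fin.cases ?_ (fun j => ?_) j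
    · refine Finset.sum_eq_zero fun n _ => ?_
      rw [expCoeff_of_neg y (k := ((0 : Fin (L + 1)) : ℕ) - _) (by simp; lia), mul_zero]
    · simp only [Fin.cases_succ]
      rw [cylMatrix_apply, Finset.mul_sum]
      refine Finset.sum_congr rfl fun n _ => ?_
      simp only [Fin.val_succ, Nat.cast_add, Nat.cast_one, add_sub_add_right_eq_sub]
      ring

theorem det_updateRow_cylMatrix (q y z : ℝ) (L : ℕ) :
    det ((1 + z • cylMatrix q y (L + 1)).updateRow 0 fun j => expCoeff y (j : ℕ)) =
      det (1 + (z * q) • cylMatrix q y L) := by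
  have h : det ((1 + z • cylMatrix q y (L + 1)).updateRow 0 fun j => expCoeff y (j : ℕ)) =
      det (of fun i j : Fin (L + 1) => Fin.cases (expCoeff y (j : ℕ))
        (fun i => Fin.cases 0 (fun j => (1 + (z * q) • cylMatrix q y L) i j) j) i) := by
    refine det_eq_of_forall_row_eq_smul_add_const
      (Fin.cases 0 fun i => z * expCoeff y (i.succ : ℕ)) 0 rfl fun i j => ?_
    refine Fin.cases ?_ (fun i => ?_) i
    · simp
    · rw [updateRow_ne (Fin.succ_ne_zero i), Matrix.add_apply, Matrix.smul_apply, cylMatrix_succ]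
      refine Fin.cases ?_ (fun j => ?_) j
      · simp [one_apply, expCoeff_zero]
      · simp [one_apply]
        ring
  rw [h, det_succ_column_zero, Fin.sum_univ_succ, Finset.sum_eq_zero]
  · simp [expCoeff_zero]
    rfl
  · intro i _
    simp

theorem det_one_add_smul_cylMatrix_succ (q y z : ℝ) (L : ℕ) :
    det (1 + z • cylMatrix q y (L + 1)) =
      adjugate (1 + z • cylMatrix q y (L + 1)) 0 0 + z * det (1 + (z * q) • cylMatrix q y L) := by
  set M := 1 + z • cylMatrix q y (L + 1) with hM
  have h : M.updateRow 0 (Pi.single 0 1 + z • fun j : Fin (L + 1) => expCoeff y (j : ℕ)) = M := by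
    convert updateRow_eq_self M 0
    ext j
    simp [hM, cylMatrix_zero_left, one_apply, Pi.single_apply, eq_comm]
  conv_lhs => rw [← h]
  rw [det_updateRow_add, det_updateRow_smul, hM, det_updateRow_cylMatrix, adjugate_apply]

end

section

open Matrix

theorem resolvent_bounds {n : Type*} [Fintype n] [DecidableEq n] {A : Matrix n n ℝ}
    (hA : A.PosSemidef) {z : ℝ} (hz : 0 < z) {i : n} {u v : n → ℝ}
    (hu : A *ᵥ u = Pi.single i 1) (hv : (1 + z • A) *ᵥ v = Pi.single i 1) :
    z * v i ≤ u i ∧ z * u i - u ⬝ᵥ u ≤ z ^ 2 * v i := by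
  have hsymm : Aᵀ = A := by simpa using hA.isHermitian.eq
  have hpos : ∀ x : n → ℝ, 0 ≤ x ⬝ᵥ A *ᵥ x := fun x => by
    simpa using hA.dotProduct_mulVec_nonneg x
  have hself : ∀ x y : n → ℝ, x ⬝ᵥ A *ᵥ y = y ⬝ᵥ A *ᵥ x := fun x y => by
    rw [dotProduct_mulVec, ← mulVec_transpose, hsymm, dotProduct_comm]
  have hsq : ∀ x : n → ℝ, 0 ≤ x ⬝ᵥ x := fun x => Finset.sum_nonneg fun j _ => mul_self_nonneg _
  rw [add_mulVec, one_mulVec, smul_mulVec] at hv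
  set w := u - z • v with hw
  have hAw : A *ᵥ w = v := by
    rw [hw, mulVec_sub, hu, mulVec_smul, ← hv, add_sub_cancel_right]
  have huw : u = w + z • v := by rw [hw, sub_add_cancel]
  have h1 : u i = u ⬝ᵥ v + z * v i := by
    have : u ⬝ᵥ (Pi.single i 1 : n → ℝ) = u i := by simp
    rw [← this, ← hv, dotProduct_add, dotProduct_smul, hself, hu]
    simp
  have h2 : 0 ≤ u ⬝ᵥ v := by
    have h : u ⬝ᵥ v = w ⬝ᵥ A *ᵥ w + z * (v ⬝ᵥ v) := by
      rw [huw, add_dotProduct, smul_dotProduct, smul_eq_mul, hAw]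
    rw [h]
    exact add_nonneg (hpos w) (mul_nonneg hz.le (hsq v))
  have h3 : z * (u ⬝ᵥ v) ≤ u ⬝ᵥ u := by
    have h : u ⬝ᵥ u - z * (u ⬝ᵥ v) = w ⬝ᵥ w + z * (w ⬝ᵥ A *ᵥ w) := by
      rw [hAw, ← smul_eq_mul, ← smul_eq_mul, ← dotProduct_smul, ← dotProduct_sub, ← hw]
      conv_lhs => rw [huw]
      rw [add_dotProduct, smul_dotProduct, dotProduct_comm v w]
    have := mul_nonneg hz.le (hpos w)
    have := hsq w
    linarith
  constructor
  · linarith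
  · nlinarith

/-- The partial sums of the power series of `besselI0 (2 * x)`. -/
noncomputable def besselSum (x : ℝ) (L : ℕ) : ℝ := ∑ n ∈ Finset.range L, expCoeff x n ^ 2

theorem sum_expCoeff_mul_le (x : ℝ) (L j : ℕ) :
    ∑ n ∈ Finset.range L, expCoeff x ((n : ℤ) - j) * expCoeff x n ≤ besselSum x L := by
  have h : ∑ n ∈ Finset.range L, expCoeff x ((n : ℤ) - j) ^ 2 ≤ besselSum x L := by
    have h1 : ∑ n ∈ Finset.range L, expCoeff x ((n : ℤ) - j) ^ 2 =
        ∑ n ∈ Finset.range (L - j), expCoeff x n ^ 2 := by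
      rw [← Finset.sum_subset (s₁ := Finset.Ico j L), Finset.sum_Ico_eq_sum_range]
      · simp
      · intro n
        simp only [Finset.mem_Ico, Finset.mem_range]
        lia
      · intro n hn hn'
        simp only [Finset.mem_Ico, Finset.mem_range] at hn hn'
        rw [expCoeff_of_neg x (by lia), zero_pow two_ne_zero]
    rw [h1]
    exact Finset.sum_le_sum_of_subset_of_nonneg (Finset.range_mono (Nat.sub_le _ _))
      fun _ _ _ => sq_nonneg _
  have h2 : 2 * ∑ n ∈ Finset.range L, expCoeff x ((n : ℤ) - j) * expCoeff x n ≤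
      ∑ n ∈ Finset.range L, expCoeff x ((n : ℤ) - j) ^ 2 + besselSum x L := by
    rw [besselSum, ← Finset.sum_add_distrib, Finset.mul_sum]
    refine Finset.sum_le_sum fun n _ => ?_
    rw [← mul_assoc]
    exact two_mul_le_add_sq _ _
  linarith

theorem sum_pow_mul_sum_expCoeff_le {t x : ℝ} (ht : 0 < t) (hx : 0 ≤ x) (L : ℕ) :
    ∑ j ∈ Finset.range L, t ^ (2 * j) *
        ∑ n ∈ Finset.range L, expCoeff x ((n : ℤ) - j) * expCoeff x n ≤
      Real.exp (x * (t ^ 2 + (t ^ 2)⁻¹)) := by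
  have ht2 : 0 < t ^ 2 := by positivity
  calc _ = ∑ n ∈ Finset.range L, expCoeff (t ^ 2 * x) n *
        ∑ j ∈ Finset.range (n + 1), expCoeff ((t ^ 2)⁻¹ * x) j := by
        simp only [Finset.mul_sum]
        rw [Finset.sum_comm]
        refine Finset.sum_congr rfl fun n hn => ?_
        rw [Finset.mem_range] at hn
        rw [← Finset.sum_range_reflect _ (n + 1)]
        symm
        refine Finset.sum_subset_zero_on_sdiff (Finset.range_mono hn) (fun j hj => ?_)
          fun j hj => ?_
        · simp only [Finset.mem_sdiff, Finset.mem_range] at hj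
          rw [expCoeff_of_neg x (by lia), zero_mul, mul_zero]
        · rw [Finset.mem_range] at hj
          obtain ⟨m, rfl⟩ := Nat.exists_eq_add_of_le (Nat.lt_succ_iff.mp hj)
          rw [show j + m + 1 - 1 - j = m by lia, ← pow_mul_expCoeff, ← pow_mul_expCoeff,
            show ((j + m : ℕ) : ℤ) - j = (m : ℕ) by lia, pow_add, inv_pow, pow_mul]
          field_simp
    _ ≤ ∑ n ∈ Finset.range L, expCoeff (t ^ 2 * x) n * Real.exp ((t ^ 2)⁻¹ * x) := by
        gcongr with n _
        · exact expCoeff_nonneg (by positivity) _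
        · exact sum_expCoeff_le_exp (by positivity) _
    _ ≤ Real.exp (t ^ 2 * x) * Real.exp ((t ^ 2)⁻¹ * x) := by
        rw [← Finset.sum_mul]
        gcongr
        exact sum_expCoeff_le_exp (by positivity) _
    _ = _ := by
        rw [← Real.exp_add]
        ring_nf

theorem besselSum_nonneg (x : ℝ) (L : ℕ) : 0 ≤ besselSum x L :=
  Finset.sum_nonneg fun _ _ => sq_nonneg _

/-- The first column of the inverse of `cylMatrix`. -/
noncomputable def cylInvColumn (q y : ℝ) (L : ℕ) : Fin (L + 1) → ℝ :=
  ((expMatrix (-y) (L + 1))ᵀ * diagonal (fun n : Fin (L + 1) => (q ^ (n : ℕ))⁻¹) *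
    expMatrix (-y) (L + 1)) *ᵥ Pi.single 0 1

theorem cylMatrix_mulVec_cylInvColumn {q : ℝ} (hq : 0 < q) (y : ℝ) (L : ℕ) :
    cylMatrix q y (L + 1) *ᵥ cylInvColumn q y L = Pi.single 0 1 := by
  have h1 := expMatrix_mul_expMatrix_neg y (L + 1)
  have h2 := mul_eq_one_comm.mp h1
  have h3 : (expMatrix y (L + 1))ᵀ * (expMatrix (-y) (L + 1))ᵀ = 1 := by
    rw [← transpose_mul, h2, transpose_one]
  have h4 : diagonal (fun n : Fin (L + 1) => q ^ (n : ℕ)) *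
      diagonal (fun n : Fin (L + 1) => (q ^ (n : ℕ))⁻¹) = 1 := by
    rw [diagonal_mul_diagonal, ← diagonal_one]
    congr 1
    ext n
    exact mul_inv_cancel₀ (by positivity)
  rw [cylInvColumn, mulVec_mulVec, cylMatrix]
  rw [show ∀ B D T T' D' B' : Matrix (Fin (L + 1)) (Fin (L + 1)) ℝ,
    B * D * T * (T' * D' * B') = B * (D * (T * T') * D') * B' from fun _ _ _ _ _ _ => by
      simp only [Matrix.mul_assoc], h3, Matrix.mul_one, h4, Matrix.mul_one, h1, one_mulVec]

theorem cylInvColumn_apply (q y : ℝ) (L : ℕ) (j : Fin (L + 1)) :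
    cylInvColumn q y L j = ∑ n ∈ Finset.range (L + 1),
      expCoeff (-y) ((n : ℤ) - (j : ℕ)) * (q ^ n)⁻¹ * expCoeff (-y) n := by
  rw [cylInvColumn, mulVec_single_one, col_apply, mul_apply, Finset.sum_range]
  simp [mul_diagonal, expMatrix]

theorem abs_cylInvColumn_le {q t y : ℝ} (ht : 0 < t) (hqt : q * t ^ 2 = 1) (hy : 0 ≤ y) (L : ℕ)
    (j : Fin (L + 1)) : |cylInvColumn q y L j| ≤ t ^ (j : ℕ) * ∑ n ∈ Finset.range (L + 1),
      expCoeff (t * y) ((n : ℤ) - (j : ℕ)) * expCoeff (t * y) n := by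
  rw [cylInvColumn_apply, Finset.mul_sum]
  refine (Finset.abs_sum_le_sum_abs _ _).trans (Finset.sum_le_sum fun n _ => ?_)
  rcases lt_or_ge n (j : ℕ) with hn | hn
  · rw [expCoeff_of_neg (-y) (by lia), expCoeff_of_neg (t * y) (by lia)]
    simp
  · obtain ⟨m, rfl⟩ := Nat.exists_eq_add_of_le hn
    have hq : q⁻¹ = t ^ 2 := inv_eq_of_mul_eq_one_right hqt
    rw [abs_mul, abs_mul, abs_expCoeff_neg hy, abs_expCoeff_neg hy, ← inv_pow, hq,
      show (((j : ℕ) + m : ℕ) : ℤ) - (j : ℕ) = (m : ℕ) by lia, ← pow_mul_expCoeff,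
      ← pow_mul_expCoeff, abs_of_nonneg (by positivity)]
    apply le_of_eq
    ring

theorem cylInvColumn_zero {q t y : ℝ} (hqt : q * t ^ 2 = 1) (L : ℕ) :
    cylInvColumn q y L 0 = besselSum (t * y) (L + 1) := by
  rw [cylInvColumn_apply, besselSum]
  refine Finset.sum_congr rfl fun n _ => ?_
  have hq : q⁻¹ = t ^ 2 := inv_eq_of_mul_eq_one_right hqt
  rw [← pow_mul_expCoeff, ← inv_pow, hq, Fin.val_zero, Nat.cast_zero, sub_zero, expCoeff_natCast,
    expCoeff_natCast]
  rcases n.even_or_odd with h | h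
  · rw [h.neg_pow]; ring
  · rw [h.neg_pow]; ring

theorem cylInvColumn_dotProduct_self_le {q t y : ℝ} (ht : 0 < t) (hqt : q * t ^ 2 = 1)
    (hy : 0 ≤ y) (L : ℕ) :
    cylInvColumn q y L ⬝ᵥ cylInvColumn q y L ≤
      besselSum (t * y) (L + 1) * Real.exp (t * y * (t ^ 2 + (t ^ 2)⁻¹)) := by
  refine le_trans ?_ (mul_le_mul_of_nonneg_left
    (sum_pow_mul_sum_expCoeff_le ht (by positivity : 0 ≤ t * y) (L + 1)) (besselSum_nonneg _ _))
  rw [dotProduct, Finset.mul_sum, Finset.sum_range (n := L + 1)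
    (fun j => besselSum (t * y) (L + 1) * (t ^ (2 * j) * _))]
  refine Finset.sum_le_sum fun j _ => ?_
  have h1 := abs_cylInvColumn_le ht hqt hy L j
  have h2 := sum_expCoeff_mul_le (t * y) (L + 1) j
  set s := ∑ n ∈ Finset.range (L + 1),
    expCoeff (t * y) ((n : ℤ) - (j : ℕ)) * expCoeff (t * y) n
  have h0 : 0 ≤ s := Finset.sum_nonneg fun n _ =>
    mul_nonneg (expCoeff_nonneg (by positivity) _) (expCoeff_nonneg (by positivity) _)
  calc cylInvColumn q y L j * cylInvColumn q y L j
      = |cylInvColumn q y L j| * |cylInvColumn q y L j| := (abs_mul_abs_self _).symm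
    _ ≤ (t ^ (j : ℕ) * s) * (t ^ (j : ℕ) * s) := by gcongr
    _ = s * (t ^ (2 * (j : ℕ)) * s) := by ring
    _ ≤ _ := by gcongr

theorem det_one_add_smul_cylMatrix_bounds {q t y z : ℝ} (ht : 0 < t) (hqt : q * t ^ 2 = 1)
    (hy : 0 ≤ y) (hz : 0 < z) (L : ℕ) :
    (1 - besselSum (t * y) (L + 1) / z) * det (1 + z • cylMatrix q y (L + 1)) ≤
        z * det (1 + (z * q) • cylMatrix q y L) ∧
      z * det (1 + (z * q) • cylMatrix q y L) ≤
        (1 - besselSum (t * y) (L + 1) / z +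
          besselSum (t * y) (L + 1) * Real.exp (t * y * (t ^ 2 + (t ^ 2)⁻¹)) / z ^ 2) *
            det (1 + z • cylMatrix q y (L + 1)) := by
  have hq : 0 < q := pos_of_mul_pos_left (by rw [hqt]; exact one_pos) (by positivity)
  have hdet := det_one_add_smul_cylMatrix_pos hq.le hz.le y (L + 1)
  have hrec := det_one_add_smul_cylMatrix_succ q y z L
  have hS := cylInvColumn_dotProduct_self_le ht hqt hy L
  set M := 1 + z • cylMatrix q y (L + 1) with hM
  have hv : M *ᵥ (M.det⁻¹ • M.adjugate *ᵥ Pi.single 0 1) = Pi.single 0 1 := by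
    rw [mulVec_smul, mulVec_mulVec, mul_adjugate, smul_mulVec, one_mulVec, smul_smul,
      inv_mul_cancel₀ hdet.ne', one_smul]
  obtain ⟨h1, h2⟩ := resolvent_bounds (posSemidef_cylMatrix hq.le y (L + 1)) hz
    (cylMatrix_mulVec_cylInvColumn hq y L) hv
  rw [cylInvColumn_zero hqt] at h1 h2
  have hκ : (M.det⁻¹ • M.adjugate *ᵥ Pi.single 0 1) 0 = M.adjugate 0 0 / M.det := by
    simp [div_eq_inv_mul]
  rw [hκ] at h1 h2
  set κ := M.adjugate 0 0 / M.det with hκ'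
  have h3 : z * det (1 + (z * q) • cylMatrix q y L) = (1 - κ) * M.det := by
    rw [hκ', sub_mul, div_mul_cancel₀ _ hdet.ne']
    linarith
  rw [h3]
  constructor
  · gcongr
    rw [le_div_iff₀ hz]
    linarith
  · gcongr
    rw [← sub_nonneg]
    have h4 : 1 - besselSum (t * y) (L + 1) / z +
        besselSum (t * y) (L + 1) * Real.exp (t * y * (t ^ 2 + (t ^ 2)⁻¹)) / z ^ 2 - (1 - κ) =
        (z ^ 2 * κ - z * besselSum (t * y) (L + 1) +
          besselSum (t * y) (L + 1) * Real.exp (t * y * (t ^ 2 + (t ^ 2)⁻¹))) / z ^ 2 := by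
      field_simp
      ring
    rw [h4]
    exact div_nonneg (by linarith) (by positivity)

end

section

open Matrix

theorem abs_det_le_prod_sum {n : Type*} [Fintype n] [DecidableEq n] (M : Matrix n n ℝ) :
    |M.det| ≤ ∏ i, ∑ j, |M i j| := by
  rw [← det_transpose, det_apply, Finset.prod_univ_sum, Fintype.piFinset_univ]
  calc |∑ σ : Equiv.Perm n, Equiv.Perm.sign σ • ∏ i, Mᵀ (σ i) i|
      ≤ ∑ σ : Equiv.Perm n, ∏ i, |M i (σ i)| := by
        refine (Finset.abs_sum_le_sum_abs _ _).trans_eq (Finset.sum_congr rfl fun σ _ => ?_)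
        rcases Int.units_eq_one_or (Equiv.Perm.sign σ) with h | h <;> simp [h, Finset.abs_prod]
    _ = ∑ p ∈ Finset.univ.map ⟨fun σ : Equiv.Perm n => (σ : n → n), DFunLike.coe_injective⟩,
          ∏ i, |M i (p i)| := by simp
    _ ≤ _ := Finset.sum_le_sum_of_subset_of_nonneg (Finset.subset_univ _)
        fun _ _ _ => Finset.prod_nonneg fun _ _ => abs_nonneg _

theorem cylMatrix_nonneg {q y : ℝ} (hq : 0 ≤ q) (hy : 0 ≤ y) {L : ℕ} (i j : Fin L) :
    0 ≤ cylMatrix q y L i j := by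
  rw [cylMatrix_apply]
  exact Finset.sum_nonneg fun n _ => mul_nonneg (mul_nonneg (expCoeff_nonneg hy _)
    (pow_nonneg hq _)) (expCoeff_nonneg hy _)

theorem sum_cylMatrix_le {q y : ℝ} (hq : 0 ≤ q) (hq1 : q < 1) (hy : 0 ≤ y) (L : ℕ) :
    ∑ i, ∑ j, cylMatrix q y L i j ≤ Real.exp y ^ 2 / (1 - q) := by
  have hcol : ∀ n : Fin L, ∑ i : Fin L, expCoeff y ((i : ℕ) - (n : ℕ)) ≤ Real.exp y := by
    intro n
    refine le_trans ?_ (sum_expCoeff_le_exp hy (L - n))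
    rw [Fin.sum_univ_eq_sum_range (fun i => expCoeff y ((i : ℤ) - (n : ℕ))),
      ← Finset.sum_subset (s₁ := Finset.Ico (n : ℕ) L), Finset.sum_Ico_eq_sum_range]
    · simp
    · intro i
      simp only [Finset.mem_Ico, Finset.mem_range]
      lia
    · intro i hi hi'
      simp only [Finset.mem_Ico, Finset.mem_range] at hi hi'
      rw [expCoeff_of_neg y (by lia)]
  have h0 : ∀ n : Fin L, 0 ≤ ∑ i : Fin L, expCoeff y ((i : ℕ) - (n : ℕ)) := fun n =>
    Finset.sum_nonneg fun i _ => expCoeff_nonneg hy _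
  calc ∑ i, ∑ j, cylMatrix q y L i j
      = ∑ n : Fin L, q ^ (n : ℕ) * (∑ i : Fin L, expCoeff y ((i : ℕ) - (n : ℕ))) ^ 2 := by
        simp only [cylMatrix_apply]
        rw [Finset.sum_congr rfl fun i _ => Finset.sum_comm, Finset.sum_comm]
        refine Finset.sum_congr rfl fun n _ => ?_
        rw [pow_two, Finset.sum_mul_sum, Finset.mul_sum]
        refine Finset.sum_congr rfl fun i _ => ?_
        rw [Finset.mul_sum]
        exact Finset.sum_congr rfl fun j _ => by ring
    _ ≤ ∑ n : Fin L, q ^ (n : ℕ) * Real.exp y ^ 2 := by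
        gcongr with n _
        · exact h0 n
        · exact hcol n
    _ ≤ _ := by
        rw [← Finset.sum_mul, Fin.sum_univ_eq_sum_range (fun n => q ^ n), div_eq_inv_mul]
        gcongr
        rw [← tsum_geometric_of_lt_one hq hq1]
        exact (summable_geometric_of_lt_one hq hq1).sum_le_tsum _ fun n _ => pow_nonneg hq n

theorem det_one_add_smul_cylMatrix_le {q y z : ℝ} (hq : 0 ≤ q) (hq1 : q < 1) (hy : 0 ≤ y)
    (hz : 0 ≤ z) (L : ℕ) :
    det (1 + z • cylMatrix q y L) ≤ Real.exp (z * (Real.exp y ^ 2 / (1 - q))) := by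
  refine (le_abs_self _).trans ((abs_det_le_prod_sum _).trans ?_)
  refine le_trans ?_ (Real.exp_le_exp.mpr (mul_le_mul_of_nonneg_left
    (sum_cylMatrix_le hq hq1 hy L) hz))
  rw [Finset.mul_sum, Real.exp_sum]
  refine Finset.prod_le_prod (fun _ _ => Finset.sum_nonneg fun _ _ => abs_nonneg _) fun i _ => ?_
  calc ∑ j, |(1 + z • cylMatrix q y L) i j|
      ≤ ∑ j, ((if i = j then 1 else 0) + z * cylMatrix q y L i j) := by
        refine Finset.sum_le_sum fun j _ => le_of_eq ?_
        have := mul_nonneg hz (cylMatrix_nonneg (L := L) hq hy i j)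
        rw [Matrix.add_apply, one_apply, Matrix.smul_apply, smul_eq_mul, abs_of_nonneg]
        split_ifs <;> linarith
    _ = z * ∑ j, cylMatrix q y L i j + 1 := by
        rw [Finset.sum_add_distrib, ← Finset.mul_sum]
        simp [add_comm]
    _ ≤ _ := Real.add_one_le_exp _

/-- The power series of `besselI0 (2 * x)`. -/
noncomputable def besselSeries (x : ℝ) : ℝ := ∑' n : ℕ, expCoeff x n ^ 2

theorem summable_expCoeff_sq (x : ℝ) : Summable fun n : ℕ => expCoeff x n ^ 2 := by
  refine Summable.of_nonneg_of_le (fun _ => sq_nonneg _) (fun n => ?_)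
    (Real.summable_pow_div_factorial (x ^ 2))
  rw [expCoeff_natCast, div_pow, ← pow_mul, ← pow_mul, mul_comm n 2]
  gcongr
  · exact (even_two_mul n).pow_nonneg x
  · exact_mod_cast Nat.le_self_pow two_ne_zero _

theorem besselSum_le_besselSeries (x : ℝ) (L : ℕ) : besselSum x L ≤ besselSeries x :=
  (summable_expCoeff_sq x).sum_le_tsum _ fun _ _ => sq_nonneg _

theorem tendsto_besselSum (x : ℝ) :
    Filter.Tendsto (besselSum x) Filter.atTop (nhds (besselSeries x)) :=
  (summable_expCoeff_sq x).hasSum.tendsto_sum_nat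

theorem besselSeries_pos (x : ℝ) : 0 < besselSeries x := by
  refine lt_of_lt_of_le ?_ (besselSum_le_besselSeries x 1)
  simp [besselSum, expCoeff_zero]

namespace IntPartition

theorem cpmWeight_nonneg {q : ℝ} (hq : 0 ≤ q) (y : ℝ) (lam : IntPartition) :
    0 ≤ cpmWeight q y lam :=
  tsum_nonneg fun mu => by
    split_ifs
    · positivity
    · exact le_rfl

theorem boxSum_nonneg {q : ℝ} (hq : 0 ≤ q) (y : ℝ) (M N : ℕ) : 0 ≤ boxSum q y M N :=
  tsum_nonneg fun lam => by
    split_ifs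
    · exact cpmWeight_nonneg hq y lam
    · exact le_rfl

end IntPartition

/-- The expansion of the determinant in terms of the number of columns. -/
theorem det_one_add_smul_cylMatrix' (q y z : ℝ) (L : ℕ) :
    det (1 + z • cylMatrix q y L) = ∑ k ∈ Finset.range (L + 1),
      z ^ k * (q ^ (∑ i ∈ Finset.range k, i) * IntPartition.boxSum q y (L - k) k) := by
  rw [det_one_add_smul_cylMatrix]
  simp only [IntPartition.boxSum_comm]

theorem exp_neg_le_one_sub_half {x : ℝ} (h0 : 0 ≤ x) (h1 : x ≤ 1) : Real.exp (-x) ≤ 1 - x / 2 := by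
  have h2 := Real.add_one_le_exp x
  rw [Real.exp_neg]
  refine (inv_anti₀ (by linarith) h2).trans ?_
  rw [inv_le_iff_one_le_mul₀ (by linarith)]
  nlinarith

theorem det_one_add_smul_cylMatrix_mul_exp_le {q t y : ℝ} (ht : 0 < t) (hqt : q * t ^ 2 = 1)
    (hq1 : q ≤ 1) (hy : 0 ≤ y) (M N : ℕ) :
    det (1 + (2 * besselSeries (t * y) / q ^ N) • cylMatrix q y (M + N)) *
        Real.exp (-∑ j ∈ Finset.range N, q ^ (j + 1)) ≤
      (∏ j ∈ Finset.range N, 2 * besselSeries (t * y) / q ^ (j + 1)) *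
        det (1 + (2 * besselSeries (t * y)) • cylMatrix q y M) := by
  have hq : 0 < q := pos_of_mul_pos_left (by rw [hqt]; exact one_pos) (by positivity)
  have hI := besselSeries_pos (t * y)
  set J := besselSeries (t * y) with hJ
  induction N with
  | zero => simp
  | succ N ih =>
    have hz : 0 < 2 * J / q ^ (N + 1) := by positivity
    have h1 := (det_one_add_smul_cylMatrix_bounds ht hqt hy hz (M + N)).1
    rw [show 2 * J / q ^ (N + 1) * q = 2 * J / q ^ N by rw [pow_succ]; field_simp] at h1
    have hdet := det_one_add_smul_cylMatrix_pos hq.le hz.le y (M + N + 1)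
    have h2 : Real.exp (-q ^ (N + 1)) ≤
        1 - besselSum (t * y) (M + N + 1) / (2 * J / q ^ (N + 1)) := by
      refine (exp_neg_le_one_sub_half (by positivity) (pow_le_one₀ hq.le hq1)).trans ?_
      refine sub_le_sub_left ?_ 1
      rw [div_div_eq_mul_div, div_le_div_iff₀ (by positivity) (by positivity)]
      have := besselSum_le_besselSeries (t * y) (M + N + 1)
      have hqN : 0 < q ^ (N + 1) := by positivity
      nlinarith
    rw [Finset.sum_range_succ, neg_add, Real.exp_add, Finset.prod_range_succ, ← add_assoc]
    calc _ = Real.exp (-q ^ (N + 1)) *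
          det (1 + (2 * J / q ^ (N + 1)) • cylMatrix q y (M + N + 1)) *
          Real.exp (-∑ j ∈ Finset.range N, q ^ (j + 1)) := by ring
      _ ≤ 2 * J / q ^ (N + 1) * det (1 + (2 * J / q ^ N) • cylMatrix q y (M + N)) *
          Real.exp (-∑ j ∈ Finset.range N, q ^ (j + 1)) := by
        refine mul_le_mul_of_nonneg_right ?_ (Real.exp_pos _).le
        exact (mul_le_mul_of_nonneg_right h2 hdet.le).trans h1
      _ ≤ 2 * J / q ^ (N + 1) * ((∏ j ∈ Finset.range N, 2 * J / q ^ (j + 1)) *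
          det (1 + (2 * J) • cylMatrix q y M)) := by
        rw [mul_assoc]
        gcongr
      _ = _ := by ring

namespace IntPartition

theorem boxSum_le {q t y : ℝ} (ht : 0 < t) (hqt : q * t ^ 2 = 1) (hq1 : q < 1) (hy : 0 ≤ y)
    (M N : ℕ) : boxSum q y M N ≤ Real.exp (2 * besselSeries (t * y) *
      (Real.exp y ^ 2 / (1 - q)) + (1 - q)⁻¹) := by
  have hq : 0 < q := pos_of_mul_pos_left (by rw [hqt]; exact one_pos) (by positivity)
  have hI := besselSeries_pos (t * y)
  have h1 := det_one_add_smul_cylMatrix_mul_exp_le ht hqt hq1.le hy M N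
  set J := besselSeries (t * y) with hJ
  have hP : (2 * J / q ^ N) ^ N * q ^ (∑ i ∈ Finset.range N, i) =
      ∏ j ∈ Finset.range N, 2 * J / q ^ (j + 1) := by
    have hc : (2 * J / q ^ N) ^ N = ∏ _j ∈ Finset.range N, 2 * J / q ^ N := by
      rw [Finset.prod_const, Finset.card_range]
    rw [← Finset.prod_range_reflect, ← Finset.prod_pow_eq_pow_sum, hc,
      ← Finset.prod_mul_distrib]
    refine Finset.prod_congr rfl fun j hj => ?_
    rw [Finset.mem_range] at hj
    obtain ⟨m, rfl⟩ := Nat.exists_eq_add_of_lt hj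
    rw [show j + m + 1 - 1 - j + 1 = m + 1 by lia, show j + m + 1 = j + (m + 1) by lia, pow_add]
    field_simp
  have h2 : (2 * J / q ^ N) ^ N * q ^ (∑ i ∈ Finset.range N, i) * boxSum q y M N ≤
      det (1 + (2 * J / q ^ N) • cylMatrix q y (M + N)) := by
    rw [det_one_add_smul_cylMatrix', mul_assoc]
    have h := Finset.single_le_sum (s := Finset.range (M + N + 1)) (a := N)
      (f := fun k => (2 * J / q ^ N) ^ k *
        (q ^ (∑ i ∈ Finset.range k, i) * boxSum q y (M + N - k) k))
      (fun k _ => mul_nonneg (by positivity) (mul_nonneg (by positivity)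
        (boxSum_nonneg hq.le y _ _))) (by simp)
    simpa using h
  rw [hP] at h2
  set P := ∏ j ∈ Finset.range N, 2 * J / q ^ (j + 1) with hP'
  have hPpos : 0 < P := Finset.prod_pos fun j _ => by positivity
  set s := ∑ j ∈ Finset.range N, q ^ (j + 1) with hs
  have hs1 : s ≤ (1 - q)⁻¹ := by
    rw [← tsum_geometric_of_lt_one hq.le hq1]
    refine le_trans (Finset.sum_le_sum fun j _ => ?_)
      ((summable_geometric_of_lt_one hq.le hq1).sum_le_tsum (Finset.range N) fun n _ =>
        pow_nonneg hq.le n)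
    exact pow_le_pow_of_le_one hq.le hq1.le (Nat.le_succ j)
  have h3 : boxSum q y M N * Real.exp (-s) ≤ det (1 + (2 * J) • cylMatrix q y M) := by
    refine le_of_mul_le_mul_left ?_ hPpos
    calc P * (boxSum q y M N * Real.exp (-s)) = P * boxSum q y M N * Real.exp (-s) := by ring
      _ ≤ _ := (mul_le_mul_of_nonneg_right h2 (Real.exp_pos _).le).trans h1
  have h4 := h3.trans (det_one_add_smul_cylMatrix_le hq.le hq1 hy (by positivity) M)
  rw [Real.exp_neg, ← div_eq_mul_inv, div_le_iff₀ (Real.exp_pos _), ← Real.exp_add] at h4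
  exact h4.trans (Real.exp_le_exp.mpr (by gcongr))

theorem summable_cpmWeight {q t y : ℝ} (ht : 0 < t) (hqt : q * t ^ 2 = 1) (hq1 : q < 1)
    (hy : 0 ≤ y) : Summable (cpmWeight q y) := by
  classical
  have hq : 0 < q := pos_of_mul_pos_left (by rw [hqt]; exact one_pos) (by positivity)
  refine summable_of_sum_le (fun lam => cpmWeight_nonneg hq.le y lam)
    (fun u => le_trans ?_ (boxSum_le ht hqt hq1 hy
      (∑ lam ∈ u, lam.exists_part_eq_zero.choose) (∑ lam ∈ u, lam.part 0)))
  set M := ∑ lam ∈ u, lam.exists_part_eq_zero.choose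
  set N := ∑ lam ∈ u, lam.part 0
  have hmem : ∀ lam ∈ u, lam.part M = 0 ∧ lam.part 0 ≤ N := fun lam hlam =>
    ⟨part_eq_zero_of_le lam.exists_part_eq_zero.choose_spec
      (Finset.single_le_sum (f := fun lam : IntPartition => lam.exists_part_eq_zero.choose)
        (fun _ _ => Nat.zero_le _) hlam),
      Finset.single_le_sum (f := fun lam : IntPartition => lam.part 0)
        (fun _ _ => Nat.zero_le _) hlam⟩
  rw [boxSum]
  refine le_trans (le_of_eq (Finset.sum_congr rfl fun lam hlam => (if_pos (hmem lam hlam)).symm))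
    (Summable.sum_le_tsum u (fun lam _ => ?_) (summable_of_hasFiniteSupport ?_))
  · split_ifs
    · exact cpmWeight_nonneg hq.le y lam
    · exact le_rfl
  · have : Finite {lam : IntPartition // lam.part M = 0 ∧ lam.part 0 ≤ N} :=
      Finite.of_equiv _ (boxEquiv M N).symm
    have hfin : {lam : IntPartition | lam.part M = 0 ∧ lam.part 0 ≤ N}.Finite := this
    refine hfin.subset fun lam hlam => ?_
    by_contra hc
    exact hlam (if_neg hc)

end IntPartition

end

section

open Matrix Filter Topology

namespace IntPartition

/-- The total cylindric Plancherel weight of the partitions with largest part at most `n`. -/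
noncomputable def cumWeight (q y : ℝ) (n : ℤ) : ℝ :=
  ∑' lam : IntPartition, if (lam.part 0 : ℤ) ≤ n then cpmWeight q y lam else 0

/-- `boxSum` for the `(L - n) × n` box, extended by zero to all integers `n`. -/
noncomputable def boxInt (q y : ℝ) (L : ℕ) (n : ℤ) : ℝ :=
  if 0 ≤ n ∧ n ≤ L then boxSum q y (L - n).toNat n.toNat else 0

/-- The empty partition. -/
def empty : IntPartition := ⟨fun _ => 0, fun _ _ _ => le_rfl, by simp [Function.support]⟩

section

variable {q y : ℝ}

theorem summable_ite_cpmWeight (hq : 0 ≤ q) (hs : Summable (cpmWeight q y))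
    (p : IntPartition → Prop) [DecidablePred p] :
    Summable fun lam => if p lam then cpmWeight q y lam else 0 :=
  hs.of_nonneg_of_le (fun lam => by split_ifs; exacts [cpmWeight_nonneg hq y lam, le_rfl])
    fun lam => by split_ifs; exacts [le_rfl, cpmWeight_nonneg hq y lam]

theorem tsum_ite_cpmWeight_le (hq : 0 ≤ q) (hs : Summable (cpmWeight q y))
    (p : IntPartition → Prop) [DecidablePred p] :
    ∑' lam, (if p lam then cpmWeight q y lam else 0) ≤ ∑' lam, cpmWeight q y lam :=
  (summable_ite_cpmWeight hq hs p).tsum_le_tsum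
    (fun lam => by split_ifs; exacts [le_rfl, cpmWeight_nonneg hq y lam]) hs

theorem cumWeight_nonneg (hq : 0 ≤ q) (y : ℝ) (n : ℤ) : 0 ≤ cumWeight q y n :=
  tsum_nonneg fun lam => by split_ifs; exacts [cpmWeight_nonneg hq y lam, le_rfl]

theorem cumWeight_le (hq : 0 ≤ q) (hs : Summable (cpmWeight q y)) (n : ℤ) :
    cumWeight q y n ≤ ∑' lam, cpmWeight q y lam :=
  tsum_ite_cpmWeight_le hq hs _

theorem cumWeight_mono (hq : 0 ≤ q) (hs : Summable (cpmWeight q y)) : Monotone (cumWeight q y) :=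
  fun m n hmn => (summable_ite_cpmWeight hq hs _).tsum_le_tsum (fun lam => by
    have := cpmWeight_nonneg hq y lam
    split_ifs
    · exact le_rfl
    · lia
    · exact this
    · exact le_rfl) (summable_ite_cpmWeight hq hs _)

theorem cumWeight_of_neg (q y : ℝ) {n : ℤ} (hn : n < 0) : cumWeight q y n = 0 := by
  rw [cumWeight]
  convert tsum_zero with lam
  exact if_neg (by lia)

theorem tendsto_cumWeight (hq : 0 ≤ q) (hs : Summable (cpmWeight q y)) :
    Tendsto (cumWeight q y) atTop (𝓝 (∑' lam, cpmWeight q y lam)) := by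
  refine tendsto_tsum_of_dominated_convergence hs (fun lam => ?_) (Eventually.of_forall fun n lam => ?_)
  · refine tendsto_const_nhds.congr' ?_
    filter_upwards [eventually_ge_atTop (lam.part 0 : ℤ)] with n hn
    exact (if_pos hn).symm
  · have := cpmWeight_nonneg hq y lam
    rw [Real.norm_eq_abs]
    split_ifs
    · rw [abs_of_nonneg this]
    · simpa using this

theorem boxInt_nonneg (hq : 0 ≤ q) (y : ℝ) (L : ℕ) (n : ℤ) : 0 ≤ boxInt q y L n := by
  rw [boxInt]
  split_ifs
  · exact boxSum_nonneg hq y _ _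
  · exact le_rfl

theorem boxInt_le (hq : 0 ≤ q) (hs : Summable (cpmWeight q y)) (L : ℕ) (n : ℤ) :
    boxInt q y L n ≤ ∑' lam, cpmWeight q y lam := by
  rw [boxInt]
  split_ifs
  · exact tsum_ite_cpmWeight_le hq hs _
  · exact tsum_nonneg fun lam => cpmWeight_nonneg hq y lam

theorem tendsto_boxInt (hq : 0 ≤ q) (hs : Summable (cpmWeight q y)) (n : ℤ) :
    Tendsto (fun L => boxInt q y L n) atTop (𝓝 (cumWeight q y n)) := by
  classical
  rcases lt_or_ge n 0 with hn | hn
  · rw [cumWeight_of_neg q y hn]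
    refine tendsto_const_nhds.congr fun L => ?_
    rw [boxInt, if_neg (by lia)]
  · have h : Tendsto (fun L : ℕ => boxSum q y (L - n).toNat n.toNat) atTop
        (𝓝 (cumWeight q y n)) := by
      refine tendsto_tsum_of_dominated_convergence hs (fun lam => ?_)
        (Eventually.of_forall fun L lam => ?_)
      · refine tendsto_const_nhds.congr' ?_
        obtain ⟨M, hM⟩ := lam.exists_part_eq_zero
        filter_upwards [eventually_ge_atTop (M + n.toNat)] with L hL
        have : lam.part (L - n).toNat = 0 := part_eq_zero_of_le hM (by lia)
        refine if_congr ?_ rfl rfl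
        simp only [this, true_and]
        lia
      · have := cpmWeight_nonneg hq y lam
        rw [Real.norm_eq_abs]
        split_ifs
        · rw [abs_of_nonneg this]
        · simpa using this
    refine h.congr' ?_
    filter_upwards [eventually_ge_atTop n.toNat] with L hL
    rw [boxInt, if_pos (by lia)]

theorem cpmWeight_empty_pos (q y : ℝ) : 0 < cpmWeight q y empty := by
  classical
  have hsize : empty.size = 0 := by simp [size, empty]
  have h : cpmWeight q y empty = (skewDim empty empty : ℝ) ^ 2 := by
    rw [cpmWeight, tsum_eq_single empty]
    · simp [hsize]
    · intro mu hmu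
      refine if_neg fun h => hmu (ext fun i => Nat.le_zero.mp (h i))
  rw [h, skewDim_eq_ncard_chains (n := 0) rfl, chains_zero_self]
  simp

theorem tsum_cpmWeight_pos (hq : 0 ≤ q) (hs : Summable (cpmWeight q y)) :
    0 < ∑' lam, cpmWeight q y lam :=
  hs.tsum_pos (fun lam => cpmWeight_nonneg hq y lam) empty (cpmWeight_empty_pos q y)

end

end IntPartition

/-- The weight `q ^ (d * (d - 1) / 2)` for `q = exp (-r)`. -/
noncomputable def gaussWeight (r : ℝ) (d : ℤ) : ℝ := Real.exp (-(r * ((d : ℝ) * (d - 1) / 2)))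

theorem gaussWeight_pos (r : ℝ) (d : ℤ) : 0 < gaussWeight r d := Real.exp_pos _

theorem summable_gaussWeight {r : ℝ} (hr : 0 < r) : Summable (gaussWeight r) := by
  have hgeom : Summable fun n : ℕ => Real.exp r * Real.exp (-r) ^ n :=
    (summable_geometric_of_lt_one (Real.exp_pos _).le (by simpa using hr)).mul_left _
  have hbound : ∀ (d : ℤ) (n : ℕ), (n : ℝ) - 1 ≤ (d : ℝ) * (d - 1) / 2 →
      gaussWeight r d ≤ Real.exp r * Real.exp (-r) ^ n := by
    intro d n h
    rw [gaussWeight, ← Real.exp_nat_mul, ← Real.exp_add]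
    refine Real.exp_le_exp.mpr ?_
    nlinarith
  refine Summable.of_nat_of_neg (hgeom.of_nonneg_of_le (fun _ => (gaussWeight_pos _ _).le)
    fun n => hbound _ _ ?_) (hgeom.of_nonneg_of_le (fun _ => (gaussWeight_pos _ _).le)
    fun n => hbound _ _ ?_)
  · have h : (0 : ℤ) ≤ ((n : ℤ) - 1) * (n - 2) := by
      rcases le_or_gt (n : ℤ) 1 with h | h
      · exact mul_nonneg_of_nonpos_of_nonpos (by lia) (by lia)
      · exact mul_nonneg (by lia) (by lia)
    have h' : (0 : ℝ) ≤ ((n : ℝ) - 1) * (n - 2) := by exact_mod_cast h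
    push_cast
    nlinarith
  · have h' : (0 : ℝ) ≤ n := Nat.cast_nonneg n
    push_cast
    nlinarith [sq_nonneg ((n : ℝ) - 1)]

/-- The finite-size distribution function of the largest part of the shift-mixed measure, up to
normalization. -/
noncomputable def mixedFinite (r y : ℝ) (L : ℕ) (s : ℤ) : ℝ :=
  Real.exp (-(r * ((s : ℝ) * (s + 1) / 2))) *
    det (1 + Real.exp (r * s) • cylMatrix (Real.exp (-r)) y L)

/-- The distribution function of the largest part of the shift-mixed measure, up to
normalization. -/
noncomputable def mixedWeight (r y : ℝ) (s : ℤ) : ℝ :=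
  ∑' d : ℤ, gaussWeight r d * IntPartition.cumWeight (Real.exp (-r)) y (s + d)

theorem mixedFinite_eq_tsum (r y : ℝ) (L : ℕ) (s : ℤ) :
    mixedFinite r y L s =
      ∑' d : ℤ, gaussWeight r d * IntPartition.boxInt (Real.exp (-r)) y L (s + d) := by
  have hsum : ∀ k : ℕ, ((∑ i ∈ Finset.range k, i : ℕ) : ℝ) = (k : ℝ) * (k - 1) / 2 := by
    intro k
    induction k with
    | zero => simp
    | succ k ih =>
      rw [Finset.sum_range_succ, Nat.cast_add, ih]
      push_cast
      ring
  have h := (Equiv.addLeft s).tsum_eq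
    (fun n => gaussWeight r (n - s) * IntPartition.boxInt (Real.exp (-r)) y L n)
  simp only [Equiv.coe_addLeft, add_sub_cancel_left] at h
  rw [h, tsum_eq_sum (s := (Finset.range (L + 1)).map Nat.castEmbedding), Finset.sum_map,
    mixedFinite, det_one_add_smul_cylMatrix', Finset.mul_sum]
  · refine Finset.sum_congr rfl fun k hk => ?_
    rw [Finset.mem_range] at hk
    rw [Nat.castEmbedding_apply, IntPartition.boxInt, if_pos (by lia),
      show ((L : ℤ) - (k : ℤ)).toNat = L - k by lia, Int.toNat_natCast, ← mul_assoc, ← mul_assoc,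
      gaussWeight, ← Real.exp_nat_mul, ← Real.exp_nat_mul, ← Real.exp_add, ← Real.exp_add, hsum]
    congr 2
    push_cast
    ring
  · intro n hn
    rw [IntPartition.boxInt, if_neg, mul_zero]
    rintro ⟨h0, h1⟩
    refine hn (Finset.mem_map.mpr ⟨n.toNat, by simp; lia, by simp [h0]⟩)

section

variable {r y : ℝ}

theorem summable_cpmWeight_exp (hr : 0 < r) (hy : 0 ≤ y) :
    Summable (cpmWeight (Real.exp (-r)) y) := by
  refine IntPartition.summable_cpmWeight (t := Real.exp (r / 2)) (Real.exp_pos _) ?_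
    (by simpa using hr) hy
  rw [← Real.exp_nat_mul, ← Real.exp_add]
  simp
  ring

theorem tendsto_mixedFinite (hr : 0 < r) (hy : 0 ≤ y) (s : ℤ) :
    Tendsto (fun L => mixedFinite r y L s) atTop (𝓝 (mixedWeight r y s)) := by
  have hq := (Real.exp_pos (-r)).le
  have hs := summable_cpmWeight_exp hr hy
  simp only [mixedFinite_eq_tsum]
  refine tendsto_tsum_of_dominated_convergence ((summable_gaussWeight hr).mul_right
    (∑' lam, cpmWeight (Real.exp (-r)) y lam))
    (fun d => (IntPartition.tendsto_boxInt hq hs _).const_mul _)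
    (Eventually.of_forall fun L d => ?_)
  · rw [Real.norm_eq_abs, abs_of_nonneg (mul_nonneg (gaussWeight_pos _ _).le
      (IntPartition.boxInt_nonneg hq y _ _))]
    exact mul_le_mul_of_nonneg_left (IntPartition.boxInt_le hq hs _ _) (gaussWeight_pos _ _).le

theorem tendsto_mixedWeight (hr : 0 < r) (hy : 0 ≤ y) :
    Tendsto (mixedWeight r y) atTop
      (𝓝 (∑' d : ℤ, gaussWeight r d * ∑' lam, cpmWeight (Real.exp (-r)) y lam)) := by
  have hq := (Real.exp_pos (-r)).le
  have hs := summable_cpmWeight_exp hr hy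
  refine tendsto_tsum_of_dominated_convergence ((summable_gaussWeight hr).mul_right
    (∑' lam, cpmWeight (Real.exp (-r)) y lam))
    (fun d => ((IntPartition.tendsto_cumWeight hq hs).comp
      (tendsto_atTop_add_const_right atTop d tendsto_id)).const_mul _)
    (Eventually.of_forall fun L d => ?_)
  · rw [Real.norm_eq_abs, abs_of_nonneg (mul_nonneg (gaussWeight_pos _ _).le
      (IntPartition.cumWeight_nonneg hq y _))]
    exact mul_le_mul_of_nonneg_left (IntPartition.cumWeight_le hq hs _) (gaussWeight_pos _ _).le

theorem mixedWeight_bounds (hr : 0 < r) (hy : 0 ≤ y) (s : ℤ) :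
    (1 - besselSeries (Real.exp (r / 2) * y) * Real.exp (-r) ^ s) * mixedWeight r y s ≤
        mixedWeight r y (s - 1) ∧
      mixedWeight r y (s - 1) ≤
        (1 - besselSeries (Real.exp (r / 2) * y) * Real.exp (-r) ^ s +
          besselSeries (Real.exp (r / 2) * y) *
            Real.exp (Real.exp (r / 2) * y * (Real.exp r + Real.exp (-r))) *
            (Real.exp (-r) ^ s) ^ 2) * mixedWeight r y s := by
  have ht2 : Real.exp (r / 2) ^ 2 = Real.exp r := by
    rw [← Real.exp_nat_mul]; congr 1; push_cast; ring
  have hqt : Real.exp (-r) * Real.exp (r / 2) ^ 2 = 1 := by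
    rw [ht2, ← Real.exp_add]; simp
  have hz : Real.exp (-r) ^ s = (Real.exp (r * s))⁻¹ := by
    rw [← Real.exp_neg, ← Real.rpow_intCast, ← Real.exp_mul]; congr 1; ring
  have hb := fun L => det_one_add_smul_cylMatrix_bounds (Real.exp_pos (r / 2)) hqt hy
    (Real.exp_pos (r * s)) L
  have h1 := tendsto_mixedFinite hr hy (s - 1)
  have h2 := (tendsto_mixedFinite hr hy s).comp (tendsto_add_atTop_nat 1)
  have h3 := (tendsto_besselSum (Real.exp (r / 2) * y)).comp (tendsto_add_atTop_nat 1)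
  set p := Real.exp (-(r * ((s : ℝ) * (s + 1) / 2))) with hp
  have hp0 : 0 < p := Real.exp_pos _
  have hrec : ∀ L, mixedFinite r y L (s - 1) = p * (Real.exp (r * s) *
      det (1 + (Real.exp (r * s) * Real.exp (-r)) • cylMatrix (Real.exp (-r)) y L)) := by
    intro L
    rw [mixedFinite, hp, ← mul_assoc, ← Real.exp_add, ← Real.exp_add]
    congr 2
    · push_cast; ring
    · congr 3
      push_cast; ring
  constructor
  · refine le_of_tendsto_of_tendsto' (((h3.mul_const _).const_sub 1).mul h2) h1 fun L => ?_
    rw [hrec, hz]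
    simp only [Function.comp_apply, mixedFinite]
    rw [← hp, mul_left_comm, ← div_eq_mul_inv]
    exact mul_le_mul_of_nonneg_left (hb L).1 hp0.le
  · refine le_of_tendsto_of_tendsto' h1 ((((h3.mul_const _).const_sub 1).add
      ((h3.mul_const _).mul_const _)).mul h2) fun L => ?_
    rw [hrec, hz]
    simp only [Function.comp_apply, mixedFinite]
    rw [← hp, mul_left_comm _ p, ← div_eq_mul_inv, inv_pow, ← div_eq_mul_inv]
    have := (hb L).2
    rw [ht2, ← Real.exp_neg] at this
    exact mul_le_mul_of_nonneg_left this hp0.le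

end

end

section

open Filter Topology

theorem le_exp_mul_of_forall_le {f c : ℕ → ℝ} {A C : ℝ} (h : ∀ n, f n ≤ Real.exp (c n) * f (n + 1))
    (hf : Tendsto f atTop (𝓝 A)) (hc : HasSum c C) : f 0 ≤ Real.exp C * A := by
  refine ge_of_tendsto' ((Real.continuous_exp.tendsto C).comp hc.tendsto_sum_nat |>.mul hf)
    fun n => ?_
  simp only [Function.comp_apply]
  induction n with
  | zero => simp
  | succ n ih =>
    refine ih.trans ?_
    rw [Finset.sum_range_succ, Real.exp_add, mul_assoc]
    exact mul_le_mul_of_nonneg_left (h n) (Real.exp_pos _).le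

theorem exp_neg_sub_sq_le {x : ℝ} (h0 : 0 ≤ x) (h1 : x ≤ 1 / 2) :
    Real.exp (-x - x ^ 2) ≤ 1 - x := by
  have h2 := Real.quadratic_le_exp_of_nonneg (x := x + x ^ 2) (by positivity)
  rw [show -x - x ^ 2 = -(x + x ^ 2) by ring, Real.exp_neg]
  refine (inv_anti₀ (by positivity) h2).trans ?_
  rw [inv_le_iff_one_le_mul₀ (by positivity)]
  have h3 : x ^ 2 ≤ (1 / 2) ^ 2 := pow_le_pow_left₀ h0 h1 2
  have h4 : x ^ 3 ≤ (1 / 2) ^ 3 := pow_le_pow_left₀ h0 h1 3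
  have h5 : 0 ≤ x ^ 2 / 2 * (1 - x - x ^ 2 - x ^ 3) :=
    mul_nonneg (by positivity) (by linarith)
  linarith

section

variable {r y : ℝ}

theorem hasSum_zpow_add_natCast {q : ℝ} (hq : 0 < q) (hq1 : q < 1) (s : ℤ) :
    HasSum (fun k : ℕ => q ^ (s + k)) (q ^ s / (1 - q)) := by
  simpa only [zpow_add₀ hq.ne', zpow_natCast, div_eq_mul_inv] using
    (hasSum_geometric_of_lt_one hq.le hq1).mul_left (q ^ s)

theorem hasSum_zpow_add_natCast_sq {q : ℝ} (hq : 0 < q) (hq1 : q < 1) (s : ℤ) :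
    HasSum (fun k : ℕ => (q ^ (s + k)) ^ 2) ((q ^ s) ^ 2 / (1 - q ^ 2)) := by
  have h := (hasSum_geometric_of_lt_one (sq_nonneg q) (by nlinarith : q ^ 2 < 1)).mul_left
    ((q ^ s) ^ 2)
  have hf : (fun k : ℕ => (q ^ (s + k)) ^ 2) = fun k : ℕ => (q ^ s) ^ 2 * (q ^ 2) ^ k := by
    funext k
    rw [zpow_add₀ hq.ne', zpow_natCast, mul_pow, ← pow_mul q k, ← pow_mul q 2, mul_comm k 2]
  rw [hf, div_eq_mul_inv]
  exact h

theorem mixedWeight_nonneg (r y : ℝ) (s : ℤ) : 0 ≤ mixedWeight r y s :=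
  tsum_nonneg fun _ => mul_nonneg (gaussWeight_pos _ _).le
    (IntPartition.cumWeight_nonneg (Real.exp_pos _).le y _)

theorem mixedWeight_le (hr : 0 < r) (hy : 0 ≤ y) (s : ℤ) :
    mixedWeight r y s ≤ Real.exp (-(besselSeries (Real.exp (r / 2) * y) *
        (Real.exp (-r) ^ (s + 1) / (1 - Real.exp (-r)))) +
      besselSeries (Real.exp (r / 2) * y) *
        Real.exp (Real.exp (r / 2) * y * (Real.exp r + Real.exp (-r))) *
          ((Real.exp (-r) ^ (s + 1)) ^ 2 / (1 - Real.exp (-r) ^ 2))) *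
      ∑' d : ℤ, gaussWeight r d * ∑' lam, cpmWeight (Real.exp (-r)) y lam := by
  have hq := Real.exp_pos (-r)
  have hq1 : Real.exp (-r) < 1 := by simpa using hr
  have h := le_exp_mul_of_forall_le (f := fun k : ℕ => mixedWeight r y (s + k)) (fun k => ?_)
    ((tendsto_mixedWeight hr hy).comp
      (tendsto_atTop_add_const_left atTop s tendsto_natCast_atTop_atTop))
    (((hasSum_zpow_add_natCast hq hq1 (s + 1)).mul_left
      (besselSeries (Real.exp (r / 2) * y))).neg.add
      ((hasSum_zpow_add_natCast_sq hq hq1 (s + 1)).mul_left (besselSeries (Real.exp (r / 2) * y) *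
        Real.exp (Real.exp (r / 2) * y * (Real.exp r + Real.exp (-r))))))
  · simpa using h
  · have hb := (mixedWeight_bounds hr hy (s + 1 + k)).2
    rw [show s + 1 + k - 1 = s + (k : ℤ) by ring] at hb
    rw [show s + ((k + 1 : ℕ) : ℤ) = s + 1 + k by push_cast; ring]
    refine hb.trans (mul_le_mul_of_nonneg_right ?_ (mixedWeight_nonneg r y _))
    refine le_trans (le_of_eq ?_) (Real.add_one_le_exp _)
    ring

theorem le_mixedWeight (hr : 0 < r) (hy : 0 ≤ y) {s : ℤ}
    (hs : besselSeries (Real.exp (r / 2) * y) * Real.exp (-r) ^ (s + 1) ≤ 1 / 2) :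
    Real.exp (-(besselSeries (Real.exp (r / 2) * y) *
        (Real.exp (-r) ^ (s + 1) / (1 - Real.exp (-r)))) -
      besselSeries (Real.exp (r / 2) * y) ^ 2 *
          ((Real.exp (-r) ^ (s + 1)) ^ 2 / (1 - Real.exp (-r) ^ 2))) *
      (∑' d : ℤ, gaussWeight r d * ∑' lam, cpmWeight (Real.exp (-r)) y lam) ≤
      mixedWeight r y s := by
  have hq := Real.exp_pos (-r)
  have hq1 : Real.exp (-r) < 1 := by simpa using hr
  have hI := besselSeries_pos (Real.exp (r / 2) * y)
  set I := besselSeries (Real.exp (r / 2) * y)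
  set q := Real.exp (-r)
  have h := le_exp_mul_of_forall_le (f := fun k : ℕ => -mixedWeight r y (s + k)) (fun k => ?_)
    ((tendsto_mixedWeight hr hy).comp
      (tendsto_atTop_add_const_left atTop s tendsto_natCast_atTop_atTop)).neg
    (((hasSum_zpow_add_natCast hq hq1 (s + 1)).mul_left I).neg.sub
      ((hasSum_zpow_add_natCast_sq hq hq1 (s + 1)).mul_left (I ^ 2)))
  · simpa using h
  · have hb := (mixedWeight_bounds hr hy (s + 1 + k)).1
    rw [show s + 1 + k - 1 = s + (k : ℤ) by ring] at hb
    rw [show s + ((k + 1 : ℕ) : ℤ) = s + 1 + k by push_cast; ring, mul_neg, neg_le_neg_iff]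
    refine le_trans (mul_le_mul_of_nonneg_right ?_ (mixedWeight_nonneg r y _)) hb
    have hle : I * q ^ (s + 1 + k) ≤ 1 / 2 := by
      refine le_trans (mul_le_mul_of_nonneg_left ?_ hI.le) hs
      exact zpow_le_zpow_right_of_le_one₀ hq hq1.le (by lia)
    refine le_trans (le_of_eq ?_) (exp_neg_sub_sq_le (by positivity) hle)
    congr 1
    ring

theorem gaussWeight_le_of_lt (hr : 0 < r) {D : ℕ} {d : ℤ} (hd : D < d) :
    gaussWeight r d ≤ gaussWeight r D * gaussWeight r (d - D) := by
  rw [gaussWeight, gaussWeight, gaussWeight, ← Real.exp_add]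
  refine Real.exp_le_exp.mpr ?_
  have h : (0 : ℝ) ≤ D * (d - D) :=
    mul_nonneg (Nat.cast_nonneg D) (sub_nonneg.mpr (by exact_mod_cast hd.le))
  push_cast
  nlinarith [mul_nonneg hr.le h]

theorem gaussWeight_le_of_lt_neg (hr : 0 < r) {D : ℕ} {d : ℤ} (hd : d < -D) :
    gaussWeight r d ≤ gaussWeight r D * gaussWeight r (d + D) := by
  rw [gaussWeight, gaussWeight, gaussWeight, ← Real.exp_add]
  refine Real.exp_le_exp.mpr ?_
  have h : (0 : ℝ) ≤ D * (-D - d) :=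
    mul_nonneg (Nat.cast_nonneg D) (sub_nonneg.mpr (by exact_mod_cast hd.le))
  have h0 : (0 : ℝ) ≤ D := Nat.cast_nonneg D
  push_cast
  nlinarith [mul_nonneg hr.le h, mul_nonneg hr.le h0]

theorem tsum_gaussWeight_pos (hr : 0 < r) : 0 < ∑' d, gaussWeight r d :=
  (summable_gaussWeight hr).tsum_pos (fun d => (gaussWeight_pos r d).le) 0 (gaussWeight_pos r 0)

theorem summable_gaussWeight_mul_cumWeight (hr : 0 < r) (hy : 0 ≤ y) (s : ℤ) :
    Summable fun d => gaussWeight r d * IntPartition.cumWeight (Real.exp (-r)) y (s + d) :=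
  ((summable_gaussWeight hr).mul_right (∑' lam, cpmWeight (Real.exp (-r)) y lam)).of_nonneg_of_le
    (fun _ => mul_nonneg (gaussWeight_pos _ _).le
      (IntPartition.cumWeight_nonneg (Real.exp_pos _).le y _))
    fun _ => mul_le_mul_of_nonneg_left (IntPartition.cumWeight_le (Real.exp_pos _).le
      (summable_cpmWeight_exp hr hy) _) (gaussWeight_pos _ _).le

theorem cumWeight_mul_le_mixedWeight (hr : 0 < r) (hy : 0 ≤ y) (N : ℤ) (D : ℕ) :
    (1 - gaussWeight r D) * (∑' d, gaussWeight r d) *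
      IntPartition.cumWeight (Real.exp (-r)) y N ≤ mixedWeight r y (N + D) := by
  have hq := (Real.exp_pos (-r)).le
  have hs := summable_cpmWeight_exp hr hy
  have hg := summable_gaussWeight hr
  set V := IntPartition.cumWeight (Real.exp (-r)) y N with hV
  have hV0 : 0 ≤ V := IntPartition.cumWeight_nonneg hq y N
  have hg2 : Summable fun d => gaussWeight r (d + D) :=
    hg.comp_injective (add_left_injective (D : ℤ))
  have hshift : ∑' d, gaussWeight r (d + D) = ∑' d, gaussWeight r d :=
    (Equiv.addRight (D : ℤ)).tsum_eq (gaussWeight r)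
  have hsum : ∑' d, (gaussWeight r d - gaussWeight r D * gaussWeight r (d + D)) * V =
      (1 - gaussWeight r D) * (∑' d, gaussWeight r d) * V := by
    rw [tsum_mul_right, hg.tsum_sub (hg2.mul_left _), tsum_mul_left, hshift]
    ring
  have hs1 : Summable fun d => (gaussWeight r d - gaussWeight r D * gaussWeight r (d + D)) * V :=
    (hg.sub (hg2.mul_left _)).mul_right V
  rw [← hsum, mixedWeight]
  refine hs1.tsum_le_tsum (fun d => ?_) (summable_gaussWeight_mul_cumWeight hr hy _)
  have h1 := gaussWeight_pos r d
  have h2 := mul_pos (gaussWeight_pos r D) (gaussWeight_pos r (d + D))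
  rcases lt_or_ge d (-D) with hd | hd
  · refine le_trans (mul_nonpos_of_nonpos_of_nonneg (sub_nonpos.mpr
      (gaussWeight_le_of_lt_neg hr hd)) hV0) ?_
    exact mul_nonneg h1.le (IntPartition.cumWeight_nonneg hq y _)
  · refine mul_le_mul (by linarith) ?_ hV0 h1.le
    exact IntPartition.cumWeight_mono hq hs (by lia)

theorem mixedWeight_le_cumWeight (hr : 0 < r) (hy : 0 ≤ y) (N : ℤ) (D : ℕ) :
    mixedWeight r y (N - D) ≤ (∑' d, gaussWeight r d) *
      (IntPartition.cumWeight (Real.exp (-r)) y N +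
        gaussWeight r D * ∑' lam, cpmWeight (Real.exp (-r)) y lam) := by
  have hq := (Real.exp_pos (-r)).le
  have hs := summable_cpmWeight_exp hr hy
  have hg := summable_gaussWeight hr
  set V := IntPartition.cumWeight (Real.exp (-r)) y N with hV
  have hV0 : 0 ≤ V := IntPartition.cumWeight_nonneg hq y N
  set T := ∑' lam, cpmWeight (Real.exp (-r)) y lam with hT
  have hT0 : 0 < T := IntPartition.tsum_cpmWeight_pos hq hs
  have hg2 : Summable fun d => gaussWeight r (d - D) :=
    hg.comp_injective (sub_left_injective (b := (D : ℤ)))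
  have hshift : ∑' d, gaussWeight r (d - D) = ∑' d, gaussWeight r d :=
    (Equiv.subRight (D : ℤ)).tsum_eq (gaussWeight r)
  have hsum : ∑' d, (gaussWeight r d * V + gaussWeight r D * gaussWeight r (d - D) * T) =
      (∑' d, gaussWeight r d) * (V + gaussWeight r D * T) := by
    rw [(hg.mul_right V).tsum_add ((hg2.mul_left _).mul_right T), tsum_mul_right, tsum_mul_right,
      tsum_mul_left, hshift]
    ring
  have hs1 : Summable fun d =>
      gaussWeight r d * V + gaussWeight r D * gaussWeight r (d - D) * T :=
    (hg.mul_right V).add ((hg2.mul_left _).mul_right T)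
  rw [← hsum, mixedWeight]
  refine (summable_gaussWeight_mul_cumWeight hr hy _).tsum_le_tsum (fun d => ?_) hs1
  have h1 := gaussWeight_pos r d
  have h2 := mul_pos (gaussWeight_pos r D) (gaussWeight_pos r (d - D))
  rcases lt_or_ge (D : ℤ) d with hd | hd
  · refine le_trans (mul_le_mul (gaussWeight_le_of_lt hr hd) (IntPartition.cumWeight_le hq hs _)
      (IntPartition.cumWeight_nonneg hq y _) h2.le) ?_
    exact le_add_of_nonneg_left (mul_nonneg h1.le hV0)
  · refine le_trans (mul_le_mul_of_nonneg_left (IntPartition.cumWeight_mono hq hs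
      (by lia : N - D + d ≤ N)) h1.le) ?_
    exact le_add_of_nonneg_right (mul_nonneg h2.le hT0.le)

/-- Upper bound for the distribution function of the largest part. -/
theorem cumWeight_div_le (hr : 0 < r) (hy : 0 ≤ y) (N : ℤ) (D : ℕ) :
    (1 - gaussWeight r D) * (IntPartition.cumWeight (Real.exp (-r)) y N /
        ∑' lam, cpmWeight (Real.exp (-r)) y lam) ≤
      Real.exp (-(besselSeries (Real.exp (r / 2) * y) *
        (Real.exp (-r) ^ (N + D + 1) / (1 - Real.exp (-r)))) +
      besselSeries (Real.exp (r / 2) * y) *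
        Real.exp (Real.exp (r / 2) * y * (Real.exp r + Real.exp (-r))) *
          ((Real.exp (-r) ^ (N + D + 1)) ^ 2 / (1 - Real.exp (-r) ^ 2))) := by
  have hT := IntPartition.tsum_cpmWeight_pos (Real.exp_pos _).le (summable_cpmWeight_exp hr hy)
  have h := (cumWeight_mul_le_mixedWeight hr hy N D).trans (mixedWeight_le hr hy (N + D))
  rw [tsum_mul_right] at h
  rw [mul_div_assoc', div_le_iff₀ hT]
  refine le_of_mul_le_mul_left ?_ (tsum_gaussWeight_pos hr)
  refine le_trans (le_of_eq ?_) (h.trans (le_of_eq ?_)) <;> ring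

/-- Lower bound for the distribution function of the largest part. -/
theorem le_cumWeight_div (hr : 0 < r) (hy : 0 ≤ y) {N : ℤ} {D : ℕ}
    (hN : besselSeries (Real.exp (r / 2) * y) * Real.exp (-r) ^ (N - D + 1) ≤ 1 / 2) :
    Real.exp (-(besselSeries (Real.exp (r / 2) * y) *
        (Real.exp (-r) ^ (N - D + 1) / (1 - Real.exp (-r)))) -
      besselSeries (Real.exp (r / 2) * y) ^ 2 *
          ((Real.exp (-r) ^ (N - D + 1)) ^ 2 / (1 - Real.exp (-r) ^ 2))) ≤
      IntPartition.cumWeight (Real.exp (-r)) y N / (∑' lam, cpmWeight (Real.exp (-r)) y lam) +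
        gaussWeight r D := by
  have hT := IntPartition.tsum_cpmWeight_pos (Real.exp_pos _).le (summable_cpmWeight_exp hr hy)
  have h := (le_mixedWeight hr hy hN).trans (mixedWeight_le_cumWeight hr hy N D)
  rw [tsum_mul_right] at h
  rw [← mul_le_mul_iff_of_pos_right hT, add_mul, div_mul_cancel₀ _ hT.ne']
  refine le_of_mul_le_mul_left ?_ (tsum_gaussWeight_pos hr)
  refine le_trans (le_of_eq ?_) h
  ring

end

end

section

open Filter Topology MeasureTheory

theorem integral_cos_pow_add_two (n : ℕ) :
    ∫ φ in (-Real.pi)..Real.pi, Real.cos φ ^ (n + 2) =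
      (n + 1) / (n + 2) * ∫ φ in (-Real.pi)..Real.pi, Real.cos φ ^ n := by
  rw [integral_cos_pow]
  simp

theorem integral_cos_pow_odd (n : ℕ) :
    ∫ φ in (-Real.pi)..Real.pi, Real.cos φ ^ (2 * n + 1) = 0 := by
  induction n with
  | zero => simp
  | succ n ih => rw [show 2 * (n + 1) + 1 = 2 * n + 1 + 2 by ring, integral_cos_pow_add_two, ih,
      mul_zero]

theorem integral_cos_pow_even (n : ℕ) :
    ∫ φ in (-Real.pi)..Real.pi, Real.cos φ ^ (2 * n) =
      2 * Real.pi * ((2 * n).factorial / (2 ^ n * n.factorial) ^ 2) := by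
  induction n with
  | zero => simp; ring
  | succ n ih =>
    rw [show 2 * (n + 1) = 2 * n + 2 by ring, integral_cos_pow_add_two, ih]
    simp only [Nat.factorial_succ, pow_succ]
    push_cast
    have h1 : ((n.factorial : ℕ) : ℝ) ≠ 0 := by positivity
    have h2 : (n : ℝ) + 1 ≠ 0 := by positivity
    field_simp
    ring

theorem besselI0_eq_besselSeries (z : ℝ) : besselI0 (2 * z) = besselSeries z := by
  have h : HasSum (fun n : ℕ => ∫ φ in (-Real.pi)..Real.pi, (2 * z * Real.cos φ) ^ n / n.factorial)
      (∫ φ in (-Real.pi)..Real.pi, Real.exp (2 * z * Real.cos φ)) := by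
    refine intervalIntegral.hasSum_integral_of_dominated_convergence
      (fun n _ => |2 * z| ^ n / n.factorial) (fun n => ?_) (fun n => ?_) ?_ ?_ ?_
    · exact Continuous.aestronglyMeasurable (by fun_prop)
    · refine .of_forall fun φ _ => ?_
      rw [norm_div, norm_pow, Real.norm_eq_abs, abs_mul, Real.norm_natCast]
      gcongr
      exact mul_le_of_le_one_right (abs_nonneg _) (Real.abs_cos_le_one φ)
    · exact .of_forall fun φ _ => Real.summable_pow_div_factorial _
    · exact intervalIntegrable_const
    · refine .of_forall fun φ _ => ?_
      rw [Real.exp_eq_exp_ℝ]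
      exact NormedSpace.expSeries_div_hasSum_exp (2 * z * Real.cos φ)
  have hterm : ∀ n : ℕ, ∫ φ in (-Real.pi)..Real.pi, (2 * z * Real.cos φ) ^ n / n.factorial =
      (2 * z) ^ n / n.factorial * ∫ φ in (-Real.pi)..Real.pi, Real.cos φ ^ n := fun n => by
    rw [← intervalIntegral.integral_const_mul]
    congr 1
    funext φ
    ring
  simp only [hterm] at h
  rw [← (mul_right_injective₀ (two_ne_zero' ℕ)).hasSum_iff] at h
  · have h2 : (∫ φ in (-Real.pi)..Real.pi, Real.exp (2 * z * Real.cos φ)) =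
        2 * Real.pi * besselSeries z := by
      refine h.unique ?_
      convert! (summable_expCoeff_sq z).hasSum.mul_left (2 * Real.pi) using 2 with n
      simp only [Function.comp_apply, integral_cos_pow_even, expCoeff_natCast]
      have h1 : ((n.factorial : ℕ) : ℝ) ≠ 0 := by positivity
      have h2 : (((2 * n).factorial : ℕ) : ℝ) ≠ 0 := by positivity
      field_simp
      ring
    rw [besselI0, h2]
    field_simp
  · intro n hn
    rcases Nat.even_or_odd' n with ⟨k, rfl | rfl⟩
    · exact absurd ⟨k, rfl⟩ hn
    · rw [integral_cos_pow_odd, mul_zero]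

theorem besselI0_pos (z : ℝ) : 0 < besselI0 z := by
  rw [← mul_div_cancel₀ z (two_ne_zero' ℝ), besselI0_eq_besselSeries]
  exact besselSeries_pos _

theorem besselI0_add_le (z δ : ℝ) : besselI0 (z + δ) ≤ Real.exp |δ| * besselI0 z := by
  rw [besselI0, besselI0, mul_left_comm,
    ← intervalIntegral.integral_const_mul (Real.exp |δ|)]
  refine mul_le_mul_of_nonneg_left (intervalIntegral.integral_mono_on
    (by linarith [Real.pi_pos]) (Continuous.intervalIntegrable (by fun_prop) _ _)
    (Continuous.intervalIntegrable (by fun_prop) _ _) fun φ _ => ?_) (by positivity)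
  rw [← Real.exp_add, Real.exp_le_exp, add_mul, add_comm]
  refine add_le_add_left ((le_abs_self _).trans ?_) _
  rw [abs_mul]
  exact mul_le_of_le_one_right (abs_nonneg _) (Real.abs_cos_le_one φ)

theorem exp_mul_one_div_sqrt_le_besselI0 {z : ℝ} (hz : 0 ≤ z) :
    Real.exp (z - 1 / 2) / (Real.pi * √(1 + z)) ≤ besselI0 z := by
  have h1 : 1 ≤ √(1 + z) := Real.one_le_sqrt.mpr (by linarith)
  set a := 1 / √(1 + z) with ha
  have ha0 : 0 < a := by positivity
  have ha1 : a ≤ 1 := (div_le_one (by positivity)).mpr h1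
  have hpi := Real.pi_gt_three
  have ha2 : z * a ^ 2 ≤ 1 := by
    rw [ha, div_pow, Real.sq_sqrt (by positivity), one_pow, mul_one_div, div_le_one (by positivity)]
    linarith
  have hle : ∫ φ in (-a)..a, Real.exp (z - 1 / 2) ≤
      ∫ φ in (-Real.pi)..Real.pi, Real.exp (z * Real.cos φ) := by
    refine (intervalIntegral.integral_mono_on (by linarith)
      (Continuous.intervalIntegrable (by fun_prop) _ _)
      (Continuous.intervalIntegrable (by fun_prop) _ _) fun φ hφ => ?_).trans
      (intervalIntegral.integral_mono_interval (by linarith) (by linarith) (by linarith)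
        (.of_forall fun φ => (Real.exp_pos _).le)
        (Continuous.intervalIntegrable (by fun_prop) _ _))
    rw [Real.exp_le_exp]
    have h2 : φ ^ 2 ≤ a ^ 2 := sq_le_sq' hφ.1 hφ.2
    have h3 := mul_le_mul_of_nonneg_left (Real.one_sub_sq_div_two_le_cos (x := φ)) hz
    have h4 := mul_le_mul_of_nonneg_left h2 hz
    linarith
  rw [intervalIntegral.integral_const, smul_eq_mul] at hle
  refine le_trans (le_of_eq ?_) (mul_le_mul_of_nonneg_left hle (by positivity :
    0 ≤ 1 / (2 * Real.pi)))
  rw [ha]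
  field_simp
  ring

end

section

open Filter Topology

section

variable {r y : ℕ → ℝ}

theorem tendsto_div_one_sub_exp_neg (hr : ∀ m, 0 < r m) (hr0 : Tendsto r atTop (𝓝 0)) :
    Tendsto (fun m => r m / (1 - Real.exp (-r m))) atTop (𝓝 1) := by
  have hexp : Tendsto (fun m => Real.exp (r m)) atTop (𝓝 1) := by
    simpa using hr0.rexp
  have hpos : ∀ m, 0 < 1 - Real.exp (-r m) := fun m => by simpa using hr m
  refine tendsto_of_tendsto_of_tendsto_of_le_of_le tendsto_const_nhds hexp (fun m => ?_)
    fun m => ?_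
  · rw [le_div_iff₀ (hpos m)]
    linarith [Real.one_sub_le_exp_neg (r m)]
  · rw [div_le_iff₀ (hpos m), mul_sub, ← Real.exp_add]
    simpa [le_sub_iff_add_le] using Real.add_one_le_exp (r m)

theorem tendsto_besselSeries_div (hy : ∀ m, 0 ≤ y m) (hr0 : Tendsto r atTop (𝓝 0))
    (hry : Tendsto (fun m => r m ^ 2 * y m) atTop (𝓝 0)) :
    Tendsto (fun m => besselSeries (Real.exp (r m / 2) * y m) / besselI0 (2 * y m + r m * y m))
      atTop (𝓝 1) := by
  have hr1 : ∀ᶠ m in atTop, |r m / 2| ≤ 1 := by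
    have h : Tendsto (fun m => |r m / 2|) atTop (𝓝 0) := by simpa using (hr0.div_const 2).abs
    exact h.eventually_le_const one_pos
  have hlow : Tendsto (fun m => Real.exp (-(r m ^ 2 * y m))) atTop (𝓝 1) := by
    simpa using hry.neg.rexp
  have hupp : Tendsto (fun m => Real.exp (r m ^ 2 * y m)) atTop (𝓝 1) := by
    simpa using hry.rexp
  have hδ : ∀ᶠ m in atTop, |2 * y m * (Real.exp (r m / 2) - 1 - r m / 2)| ≤ r m ^ 2 * y m := by
    filter_upwards [hr1] with m hm
    rw [abs_mul, abs_of_nonneg (by linarith [hy m])]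
    have h := mul_le_mul_of_nonneg_left (Real.abs_exp_sub_one_sub_id_le hm)
      (by linarith [hy m] : 0 ≤ 2 * y m)
    have h2 := mul_nonneg (sq_nonneg (r m)) (hy m)
    linarith
  refine tendsto_of_tendsto_of_tendsto_of_le_of_le' hlow hupp ?_ ?_
  · filter_upwards [hδ] with m hm
    rw [← besselI0_eq_besselSeries, le_div_iff₀ (besselI0_pos _), Real.exp_neg,
      inv_mul_le_iff₀ (Real.exp_pos _)]
    have h := besselI0_add_le (2 * (Real.exp (r m / 2) * y m))
      (-(2 * y m * (Real.exp (r m / 2) - 1 - r m / 2)))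
    rw [abs_neg, show 2 * (Real.exp (r m / 2) * y m) +
      -(2 * y m * (Real.exp (r m / 2) - 1 - r m / 2)) = 2 * y m + r m * y m by ring] at h
    exact h.trans (mul_le_mul_of_nonneg_right (Real.exp_le_exp.mpr hm) (besselI0_pos _).le)
  · filter_upwards [hδ] with m hm
    rw [← besselI0_eq_besselSeries, div_le_iff₀ (besselI0_pos _)]
    have h := besselI0_add_le (2 * y m + r m * y m)
      (2 * y m * (Real.exp (r m / 2) - 1 - r m / 2))
    rw [show 2 * y m + r m * y m + 2 * y m * (Real.exp (r m / 2) - 1 - r m / 2) =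
      2 * (Real.exp (r m / 2) * y m) by ring] at h
    exact h.trans (mul_le_mul_of_nonneg_right (Real.exp_le_exp.mpr hm) (besselI0_pos _).le)

theorem tendsto_mul_exp_div_besselSeries (hr : ∀ m, 0 < r m) (hy : ∀ m, 0 ≤ y m)
    (hr0 : Tendsto r atTop (𝓝 0)) (hry : Tendsto (fun m => r m ^ 2 * y m) atTop (𝓝 0)) :
    Tendsto (fun m => r m *
      Real.exp (Real.exp (r m / 2) * y m * (Real.exp (r m) + Real.exp (-r m))) /
        besselSeries (Real.exp (r m / 2) * y m)) atTop (𝓝 0) := by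
  have hY : Tendsto (fun m => r m ^ 2 * (2 * (Real.exp (r m / 2) * y m))) atTop (𝓝 0) := by
    have h : Tendsto (fun m => Real.exp (r m / 2)) atTop (𝓝 1) := by
      simpa using (hr0.div_const 2).rexp
    convert! (h.mul hry).const_mul 2 using 2
    · ring
    · simp
  have hbound : Tendsto (fun m => Real.pi * √(r m ^ 2 + r m ^ 2 * (2 * (Real.exp (r m / 2) * y m)))
      * Real.exp (1 / 2 + r m ^ 2 * (2 * (Real.exp (r m / 2) * y m)))) atTop (𝓝 0) := by
    have h := (((hr0.pow 2).add hY).sqrt.const_mul Real.pi).mul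
      (hY.const_add (1 / 2)).rexp
    simpa using h
  have hr1 : ∀ᶠ m in atTop, r m ≤ 1 := hr0.eventually_le_const one_pos
  refine tendsto_of_tendsto_of_tendsto_of_le_of_le' tendsto_const_nhds hbound ?_ ?_
  · refine .of_forall fun m => ?_
    exact div_nonneg (mul_nonneg (hr m).le (Real.exp_pos _).le) (besselSeries_pos _).le
  · filter_upwards [hr1] with m hm
    have hz : 0 ≤ 2 * (Real.exp (r m / 2) * y m) :=
      mul_nonneg two_pos.le (mul_nonneg (Real.exp_pos _).le (hy m))
    have hI := exp_mul_one_div_sqrt_le_besselI0 hz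
    rw [besselI0_eq_besselSeries] at hI
    have hrm := hr m
    set z := 2 * (Real.exp (r m / 2) * y m) with hz_def
    have hcosh : Real.exp (r m) + Real.exp (-r m) ≤ 2 + 2 * r m ^ 2 := by
      have h1 := (abs_le.mp (Real.abs_exp_sub_one_sub_id_le (x := r m)
        (by rwa [abs_of_pos hrm]))).2
      have h2 := (abs_le.mp (Real.abs_exp_sub_one_sub_id_le (x := -r m)
        (by rwa [abs_neg, abs_of_pos hrm]))).2
      linarith
    have hE : Real.exp (r m / 2) * y m * (Real.exp (r m) + Real.exp (-r m)) ≤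
        z - 1 / 2 + (1 / 2 + r m ^ 2 * z) := by
      have h := mul_le_mul_of_nonneg_left hcosh hz
      linarith
    have hsqrt : √(r m ^ 2 + r m ^ 2 * z) = r m * √(1 + z) := by
      rw [show r m ^ 2 + r m ^ 2 * z = r m ^ 2 * (1 + z) by ring, Real.sqrt_mul (sq_nonneg _),
        Real.sqrt_sq hrm.le]
    have hsq : 0 < √(1 + z) := Real.sqrt_pos.mpr (by linarith)
    rw [div_le_iff₀ (besselSeries_pos _), hsqrt]
    calc r m * Real.exp (Real.exp (r m / 2) * y m * (Real.exp (r m) + Real.exp (-r m)))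
        ≤ r m * (Real.exp (z - 1 / 2) * Real.exp (1 / 2 + r m ^ 2 * z)) := by
          rw [← Real.exp_add]
          exact mul_le_mul_of_nonneg_left (Real.exp_le_exp.mpr hE) hrm.le
      _ = Real.pi * (r m * √(1 + z)) * Real.exp (1 / 2 + r m ^ 2 * z) *
          (Real.exp (z - 1 / 2) / (Real.pi * √(1 + z))) := by
          field_simp
      _ ≤ _ := mul_le_mul_of_nonneg_left hI (by positivity)

theorem tendsto_sqrt_sqrt (hr : ∀ m, 0 < r m) (hr0 : Tendsto r atTop (𝓝 0)) :
    Tendsto (fun m => √√(r m)) atTop (𝓝[>] 0) := by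
  refine tendsto_nhdsWithin_iff.mpr ⟨by simpa using hr0.sqrt.sqrt, .of_forall fun m => ?_⟩
  exact Real.sqrt_pos.mpr (Real.sqrt_pos.mpr (hr m))

theorem tendsto_mul_natCeil_inv (hr : ∀ m, 0 < r m) (hr0 : Tendsto r atTop (𝓝 0)) :
    Tendsto (fun m => r m * ⌈(√√(r m) ^ 3)⁻¹⌉₊) atTop (𝓝 0) := by
  have hs := tendsto_nhds_of_tendsto_nhdsWithin (tendsto_sqrt_sqrt hr hr0)
  refine squeeze_zero (fun m => mul_nonneg (hr m).le (Nat.cast_nonneg _)) (fun m => ?_)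
    (by simpa using hs.add hr0 : Tendsto (fun m => √√(r m) + r m) atTop (𝓝 0))
  have hpos : 0 < √√(r m) := Real.sqrt_pos.mpr (Real.sqrt_pos.mpr (hr m))
  have h4 : √√(r m) ^ 4 = r m := by
    rw [show 4 = 2 * 2 from rfl, pow_mul, Real.sq_sqrt (Real.sqrt_nonneg _),
      Real.sq_sqrt (hr m).le]
  refine (mul_le_mul_of_nonneg_left (Nat.ceil_lt_add_one (by positivity)).le (hr m).le).trans
    (le_of_eq ?_)
  rw [mul_add, mul_one, add_left_inj]
  nth_rewrite 1 [← h4]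
  field_simp

theorem tendsto_gaussWeight_natCeil_inv (hr : ∀ m, 0 < r m) (hr0 : Tendsto r atTop (𝓝 0)) :
    Tendsto (fun m => gaussWeight (r m) ⌈(√√(r m) ^ 3)⁻¹⌉₊) atTop (𝓝 0) := by
  have hs := tendsto_sqrt_sqrt hr hr0
  have hs0 := tendsto_nhds_of_tendsto_nhdsWithin hs
  have hlim : Tendsto (fun m => (√√(r m))⁻¹ ^ 2 * ((1 - √√(r m) ^ 3) / 2)) atTop atTop := by
    refine Tendsto.atTop_mul_pos (C := 1 / 2) (by norm_num)
      ((tendsto_pow_atTop two_ne_zero).comp (tendsto_inv_nhdsGT_zero.comp hs)) ?_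
    simpa using ((hs0.pow 3).const_sub 1).div_const 2
  refine Real.tendsto_exp_neg_atTop_nhds_zero.comp (tendsto_atTop_mono' _ ?_ hlim)
  filter_upwards [hs0.eventually_le_const one_pos] with m hm
  have hpos : 0 < √√(r m) := Real.sqrt_pos.mpr (Real.sqrt_pos.mpr (hr m))
  have h4 : √√(r m) ^ 4 = r m := by
    rw [show 4 = 2 * 2 from rfl, pow_mul, Real.sq_sqrt (Real.sqrt_nonneg _),
      Real.sq_sqrt (hr m).le]
  have hD := Nat.le_ceil (√√(r m) ^ 3)⁻¹
  set s := √√(r m)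
  set D := ⌈(s ^ 3)⁻¹⌉₊
  have hinv : 1 ≤ (s ^ 3)⁻¹ := (one_le_inv₀ (by positivity)).mpr (pow_le_one₀ hpos.le hm)
  have hmul : (s ^ 3)⁻¹ * ((s ^ 3)⁻¹ - 1) ≤ (D : ℝ) * (D - 1) :=
    mul_le_mul hD (by linarith) (by linarith) (Nat.cast_nonneg _)
  rw [← h4, Int.cast_natCast]
  refine le_trans (le_of_eq ?_) (mul_le_mul_of_nonneg_left
    (div_le_div_of_nonneg_right hmul two_pos.le) (by positivity))
  field_simp

theorem tendsto_besselSeries_mul_zpow (hr : ∀ m, 0 < r m) (hy : ∀ m, 0 ≤ y m)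
    (hr0 : Tendsto r atTop (𝓝 0)) (hry : Tendsto (fun m => r m ^ 2 * y m) atTop (𝓝 0)) (x : ℝ)
    {k : ℕ → ℤ} (hk : Tendsto (fun m => r m * k m) atTop (𝓝 0)) :
    Tendsto (fun m => besselSeries (Real.exp (r m / 2) * y m) * (Real.exp (-r m) ^
      (⌊(r m)⁻¹ * Real.log ((r m)⁻¹ * besselI0 (2 * y m + r m * y m)) + x * (r m)⁻¹⌋ + k m) /
        (1 - Real.exp (-r m)))) atTop (𝓝 (Real.exp (-x))) := by
  have hfr : Tendsto (fun m => r m * Int.fract ((r m)⁻¹ *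
      Real.log ((r m)⁻¹ * besselI0 (2 * y m + r m * y m)) + x * (r m)⁻¹)) atTop (𝓝 0) :=
    squeeze_zero (fun m => mul_nonneg (hr m).le (Int.fract_nonneg _))
      (fun m => mul_le_of_le_one_right (hr m).le (Int.fract_lt_one _).le) hr0
  have h := (((tendsto_besselSeries_div hy hr0 hry).mul
    (tendsto_div_one_sub_exp_neg hr hr0)).mul_const (Real.exp (-x))).mul
      (hfr.sub hk).rexp
  convert! h using 2 with m
  · have hJ := besselI0_pos (2 * y m + r m * y m)
    have hrm := hr m
    set J := besselI0 (2 * y m + r m * y m)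
    set t := (r m)⁻¹ * Real.log ((r m)⁻¹ * J) + x * (r m)⁻¹ with ht
    have hrt : -(r m * t) = Real.log (r m * J⁻¹) + -x := by
      rw [show r m * J⁻¹ = ((r m)⁻¹ * J)⁻¹ by rw [mul_inv, inv_inv], Real.log_inv, ht]
      field_simp
      ring
    have hz : Real.exp (-r m) ^ (⌊t⌋ + k m) = r m * J⁻¹ * Real.exp (-x) *
        Real.exp (r m * Int.fract t - r m * k m) := by
      rw [← Real.rpow_intCast, ← Real.exp_mul, Int.cast_add,
        show -r m * ((⌊t⌋ : ℝ) + k m) = -(r m * t) + (r m * Int.fract t - r m * k m) by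
          rw [Int.fract]; ring, Real.exp_add, hrt, Real.exp_add, Real.exp_log (by positivity)]
    rw [hz]
    ring
  · simp

/-- Gumbel limit for the normalized cumulative weights. -/
theorem tendsto_cumWeight_div (hr : ∀ m, 0 < r m) (hy : ∀ m, 0 ≤ y m)
    (hr0 : Tendsto r atTop (𝓝 0)) (hry : Tendsto (fun m => r m ^ 2 * y m) atTop (𝓝 0)) (x : ℝ) :
    Tendsto (fun m => IntPartition.cumWeight (Real.exp (-r m)) (y m)
        ⌊(r m)⁻¹ * Real.log ((r m)⁻¹ * besselI0 (2 * y m + r m * y m)) + x * (r m)⁻¹⌋ /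
        ∑' lam, cpmWeight (Real.exp (-r m)) (y m) lam)
      atTop (𝓝 (Real.exp (-Real.exp (-x)))) := by
  set N : ℕ → ℤ := fun m =>
    ⌊(r m)⁻¹ * Real.log ((r m)⁻¹ * besselI0 (2 * y m + r m * y m)) + x * (r m)⁻¹⌋ with hN
  set D : ℕ → ℕ := fun m => ⌈(√√(r m) ^ 3)⁻¹⌉₊ with hD
  set I : ℕ → ℝ := fun m => besselSeries (Real.exp (r m / 2) * y m) with hI
  set E : ℕ → ℝ := fun m =>
    Real.exp (Real.exp (r m / 2) * y m * (Real.exp (r m) + Real.exp (-r m))) with hE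
  have hrD : Tendsto (fun m => r m * (D m : ℝ)) atTop (𝓝 0) := tendsto_mul_natCeil_inv hr hr0
  have hg : Tendsto (fun m => gaussWeight (r m) (D m)) atTop (𝓝 0) :=
    tendsto_gaussWeight_natCeil_inv hr hr0
  have hq : Tendsto (fun m => Real.exp (-r m)) atTop (𝓝 1) := by simpa using hr0.neg.rexp
  have hq' : Tendsto (fun m => (1 - Real.exp (-r m)) / (1 + Real.exp (-r m))) atTop (𝓝 0) := by
    simpa [Pi.div_def] using (hq.const_sub 1).div (hq.const_add 1) (by norm_num)
  have hA := tendsto_besselSeries_mul_zpow hr hy hr0 hry x (k := fun m => D m + 1)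
    (by simpa [mul_add] using hrD.add hr0)
  have hB := tendsto_besselSeries_mul_zpow hr hy hr0 hry x (k := fun m => -D m + 1)
    (by simpa [mul_add] using hrD.neg.add hr0)
  simp only [← add_assoc, ← sub_eq_add_neg] at hA hB
  change Tendsto (fun m => I m * (Real.exp (-r m) ^ (N m + D m + 1) / (1 - Real.exp (-r m))))
    atTop (𝓝 (Real.exp (-x))) at hA
  change Tendsto (fun m => I m * (Real.exp (-r m) ^ (N m - D m + 1) / (1 - Real.exp (-r m))))
    atTop (𝓝 (Real.exp (-x))) at hB
  have hpos : ∀ m, 0 < 1 - Real.exp (-r m) := fun m => by simpa using hr m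
  have hA2 : Tendsto (fun m => I m * E m *
      ((Real.exp (-r m) ^ (N m + D m + 1)) ^ 2 / (1 - Real.exp (-r m) ^ 2))) atTop (𝓝 0) := by
    have h := (((tendsto_mul_exp_div_besselSeries hr hy hr0 hry).mul (hA.pow 2)).div
      (tendsto_div_one_sub_exp_neg hr hr0) one_ne_zero).div (hq.const_add 1) (by norm_num)
    convert! h using 2 with m
    · have h1 := (hpos m).ne'
      have h2 : 1 + Real.exp (-r m) ≠ 0 := by positivity
      have h3 : I m ≠ 0 := (besselSeries_pos _).ne'
      have h4 := (hr m).ne'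
      simp only [Pi.div_apply]
      change _ = r m * E m / I m * _ / _ / _
      rw [show 1 - Real.exp (-r m) ^ 2 = (1 - Real.exp (-r m)) * (1 + Real.exp (-r m)) by ring]
      field_simp
    · simp
  have hB2 : Tendsto (fun m => I m ^ 2 *
      ((Real.exp (-r m) ^ (N m - D m + 1)) ^ 2 / (1 - Real.exp (-r m) ^ 2))) atTop (𝓝 0) := by
    have h := (hB.pow 2).mul hq'
    rw [mul_zero] at h
    refine h.congr fun m => ?_
    have h1 := (hpos m).ne'
    have h2 : 1 + Real.exp (-r m) ≠ 0 := by positivity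
    rw [show 1 - Real.exp (-r m) ^ 2 = (1 - Real.exp (-r m)) * (1 + Real.exp (-r m)) by ring]
    field_simp
  have hB3 : ∀ᶠ m in atTop, I m * Real.exp (-r m) ^ (N m - D m + 1) ≤ 1 / 2 := by
    have h := hB.mul (hq.const_sub 1)
    rw [sub_self, mul_zero] at h
    filter_upwards [h.eventually_le_const one_half_pos] with m hm
    rwa [mul_assoc, div_mul_cancel₀ _ (hpos m).ne'] at hm
  have hupp : Tendsto (fun m => Real.exp (-(I m * (Real.exp (-r m) ^ (N m + D m + 1) /
      (1 - Real.exp (-r m)))) + I m * E m * ((Real.exp (-r m) ^ (N m + D m + 1)) ^ 2 /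
        (1 - Real.exp (-r m) ^ 2))) / (1 - gaussWeight (r m) (D m)))
      atTop (𝓝 (Real.exp (-Real.exp (-x)))) := by
    simpa [Pi.div_def] using (hA.neg.add hA2).rexp.div (hg.const_sub 1) (by norm_num)
  have hlow : Tendsto (fun m => Real.exp (-(I m * (Real.exp (-r m) ^ (N m - D m + 1) /
      (1 - Real.exp (-r m)))) - I m ^ 2 * ((Real.exp (-r m) ^ (N m - D m + 1)) ^ 2 /
        (1 - Real.exp (-r m) ^ 2))) - gaussWeight (r m) (D m))
      atTop (𝓝 (Real.exp (-Real.exp (-x)))) := by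
    simpa using (hB.neg.sub hB2).rexp.sub hg
  refine tendsto_of_tendsto_of_tendsto_of_le_of_le' hlow hupp ?_ ?_
  · filter_upwards [hB3] with m hm
    rw [sub_le_iff_le_add]
    exact le_cumWeight_div (hr m) (hy m) hm
  · filter_upwards [hg.eventually_lt_const one_pos] with m hm
    rw [le_div_iff₀ (sub_pos.mpr hm), mul_comm]
    exact cumWeight_div_le (hr m) (hy m) (N m) (D m)

end

end

open scoped Classical in
theorem cpm_high_temperature_gumbel (r y : ℕ → ℝ) (hr : ∀ m, 0 < r m) (hy : ∀ m, 0 ≤ y m)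
    (hr0 : Filter.Tendsto r Filter.atTop (nhds 0))
    (hry : Filter.Tendsto (fun m => (r m) ^ 2 * y m) Filter.atTop (nhds 0)) (x : ℝ) :
    Filter.Tendsto (fun m =>
        (∑' lam : IntPartition,
            if (lam.part 0 : ℝ) ≤
                (r m)⁻¹ * Real.log ((r m)⁻¹ * besselI0 (2 * y m + r m * y m)) +
                  x * (r m)⁻¹ then
              cpmWeight (Real.exp (-r m)) (y m) lam
            else 0) /
          (∑' lam : IntPartition, cpmWeight (Real.exp (-r m)) (y m) lam))
      Filter.atTop (nhds (Real.exp (-Real.exp (-x)))) := by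
  refine (tendsto_cumWeight_div hr hy hr0 hry x).congr fun m => ?_
  congr 1
  refine tsum_congr fun lam => if_congr ?_ rfl rfl
  rw [Int.le_floor, Int.cast_natCast]
end

section
/- For every q with 0 < q < 1 and every t > 0, ( Σ_{c ∈ ℤ} q^{c²/2}·t^c ) · ∏_{k=1}^∞ (1 − q^k)^{−1} = ∏_{k=1}^∞ (1 + q^{k−1/2}·t)(1 + q^{k−1/2}·t^{−1}). -/
/-- The finite `q`-Pochhammer symbol `(q; q)_n`. -/
def qPochhammer (q : ℝ) (n : ℕ) : ℝ := ∏ k ∈ Finset.range n, (1 - q ^ (k + 1))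

/-- The Gaussian binomial coefficient, defined by the `q`-Pascal rule. -/
def qChoose (q : ℝ) : ℕ → ℕ → ℝ
  | _, 0 => 1
  | 0, _ + 1 => 0
  | n + 1, k + 1 => qChoose q n (k + 1) + q ^ (n - k) * qChoose q n k

lemma qPochhammer_succ (q : ℝ) (n : ℕ) :
    qPochhammer q (n + 1) = qPochhammer q n * (1 - q ^ (n + 1)) :=
  Finset.prod_range_succ _ _

lemma qPochhammer_pos {q : ℝ} (hq0 : 0 < q) (hq1 : q < 1) (n : ℕ) : 0 < qPochhammer q n :=
  Finset.prod_pos fun k _ => sub_pos.2 (pow_lt_one₀ hq0.le hq1 k.succ_ne_zero)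

lemma qPochhammer_antitone {q : ℝ} (hq0 : 0 < q) (hq1 : q < 1) : Antitone (qPochhammer q) := by
  refine antitone_nat_of_succ_le fun n => ?_
  rw [qPochhammer_succ]
  exact mul_le_of_le_one_right (qPochhammer_pos hq0 hq1 n).le (by simp [hq0.le])

lemma qChoose_zero_right (q : ℝ) (n : ℕ) : qChoose q n 0 = 1 := by
  cases n <;> rfl

lemma qChoose_succ_succ (q : ℝ) (n k : ℕ) :
    qChoose q (n + 1) (k + 1) = qChoose q n (k + 1) + q ^ (n - k) * qChoose q n k := rfl

lemma qChoose_eq_zero_of_lt (q : ℝ) {n k : ℕ} (h : n < k) : qChoose q n k = 0 := by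
  induction n generalizing k with
  | zero =>
    obtain ⟨k, rfl⟩ := Nat.exists_eq_succ_of_ne_zero h.ne'
    rfl
  | succ n ih =>
    obtain ⟨k, rfl⟩ := Nat.exists_eq_succ_of_ne_zero (Nat.ne_zero_of_lt h)
    rw [Nat.succ_eq_add_one, qChoose_succ_succ, ih (by omega), ih (by omega)]
    ring

lemma qChoose_self (q : ℝ) (n : ℕ) : qChoose q n n = 1 := by
  induction n with
  | zero => rfl
  | succ n ih => rw [qChoose_succ_succ, qChoose_eq_zero_of_lt q n.lt_succ_self, ih]; simp

lemma qChoose_add_mul (q : ℝ) (i j : ℕ) :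
    qChoose q (i + j) i * (qPochhammer q i * qPochhammer q j) = qPochhammer q (i + j) := by
  induction hN : i + j generalizing i j with
  | zero =>
    obtain ⟨rfl, rfl⟩ : i = 0 ∧ j = 0 := by omega
    simp [qPochhammer, qChoose_zero_right]
  | succ N ih =>
    rcases i with _ | i
    · obtain rfl : j = N + 1 := by omega
      simp [qPochhammer, qChoose_zero_right]
    rcases j with _ | j
    · obtain rfl : i = N := by omega
      rw [qChoose_self]
      simp [qPochhammer]
    · have h1 := ih (i + 1) j (by omega)
      have h2 := ih i (j + 1) (by omega)
      obtain rfl : N = i + j + 1 := by omega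
      rw [qChoose_succ_succ, show i + j + 1 - i = j + 1 by omega, qPochhammer_succ q (i + j + 1)]
      rw [qPochhammer_succ q i] at h1 ⊢
      rw [qPochhammer_succ q j] at h2 ⊢
      linear_combination (1 - q ^ (j + 1)) * h1 + q ^ (j + 1) * (1 - q ^ (i + 1)) * h2

/-- The `q`-binomial theorem. -/
lemma prod_one_add_pow_mul (q x : ℝ) (n : ℕ) :
    ∏ k ∈ Finset.range n, (1 + q ^ k * x) =
      ∑ j ∈ Finset.range (n + 1), qChoose q n j * q ^ j.choose 2 * x ^ j := by
  induction n with
  | zero => simp [qChoose_zero_right]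
  | succ n ih =>
    have hterm : ∀ j ∈ Finset.range (n + 1),
        qChoose q (n + 1) (j + 1) * q ^ (j + 1).choose 2 * x ^ (j + 1) =
          qChoose q n (j + 1) * q ^ (j + 1).choose 2 * x ^ (j + 1) +
            q ^ n * x * (qChoose q n j * q ^ j.choose 2 * x ^ j) := by
      intro j hj
      have hj : j ≤ n := by simpa [Nat.lt_succ_iff] using hj
      have hc : (j + 1).choose 2 = j + j.choose 2 := by simp [Nat.choose_succ_succ' j 1]
      have hn : q ^ n = q ^ (n - j) * q ^ j := by rw [← pow_add, Nat.sub_add_cancel hj]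
      rw [qChoose_succ_succ, hc, hn]
      ring
    rw [Finset.sum_range_succ', Finset.sum_congr rfl hterm, Finset.sum_add_distrib,
      ← Finset.mul_sum, ← ih, Finset.prod_range_succ, Finset.sum_range_succ,
      qChoose_eq_zero_of_lt q n.lt_succ_self]
    have h := Finset.sum_range_succ' (fun j => qChoose q n j * q ^ j.choose 2 * x ^ j) n
    rw [← ih] at h
    simp only [qChoose_zero_right] at h ⊢
    linear_combination h

lemma prod_rpow_neg_mul {q : ℝ} (hq : 0 < q) (t : ℝ) (n : ℕ) :
    ∏ k ∈ Finset.range n, (q ^ (-((k : ℝ) + 1 / 2)) * t) = q ^ (-((n : ℝ) ^ 2 / 2)) * t ^ n := by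
  induction n with
  | zero => simp
  | succ n ih =>
    rw [Finset.prod_range_succ, ih, show -(((n + 1 : ℕ) : ℝ) ^ 2 / 2) =
      -((n : ℝ) ^ 2 / 2) + -((n : ℝ) + 1 / 2) by push_cast; ring, Real.rpow_add hq]
    ring

/-- The finite form of the Jacobi triple product identity. -/
lemma prod_one_add_rpow_mul_one_add_rpow {q t : ℝ} (hq : 0 < q) (ht : 0 < t) (n : ℕ) :
    ∏ k ∈ Finset.range n, (1 + q ^ ((k : ℝ) + 1 / 2) * t) * (1 + q ^ ((k : ℝ) + 1 / 2) * t⁻¹) =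
      ∑ j ∈ Finset.range (2 * n + 1), qChoose q (2 * n) j *
        (q ^ ((((j : ℤ) - n : ℤ) : ℝ) ^ 2 / 2) * t ^ ((j : ℤ) - n)) := by
  have hne : q ^ (-((n : ℝ) ^ 2 / 2)) * t ^ n ≠ 0 := by positivity
  refine mul_left_cancel₀ hne ?_
  have key := prod_one_add_pow_mul q (q ^ (1 / 2 - (n : ℝ)) * t) (2 * n)
  rw [two_mul, Finset.prod_range_add, ← Finset.prod_range_reflect] at key
  rw [Finset.prod_mul_distrib, Finset.mul_sum, two_mul]
  calc _ = (∏ k ∈ Finset.range n, (1 + q ^ (n - 1 - k) * (q ^ (1 / 2 - (n : ℝ)) * t))) *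
          ∏ k ∈ Finset.range n, (1 + q ^ (n + k) * (q ^ (1 / 2 - (n : ℝ)) * t)) := by
        rw [← prod_rpow_neg_mul hq, mul_comm (∏ k ∈ Finset.range n, (1 + _ * t)), ← mul_assoc,
          ← Finset.prod_mul_distrib]
        congr 1 <;> refine Finset.prod_congr rfl fun k hk => ?_
        · have hk : k + 1 ≤ n := Finset.mem_range.1 hk
          have h1 : q ^ (n - 1 - k) * q ^ (1 / 2 - (n : ℝ)) = q ^ (-((k : ℝ) + 1 / 2)) := by
            rw [← Real.rpow_natCast, ← Real.rpow_add hq, Nat.sub_sub, add_comm 1 k,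
              Nat.cast_sub hk]
            congr 1; push_cast; ring
          rw [← mul_assoc, h1, Real.rpow_neg hq.le]
          have : q ^ ((k : ℝ) + 1 / 2) ≠ 0 := by positivity
          field_simp
          ring
        · rw [← Real.rpow_natCast q (n + k), ← mul_assoc, ← Real.rpow_add hq]
          congr 3; push_cast; ring
    _ = _ := by
        rw [key]
        refine Finset.sum_congr rfl fun j _ => ?_
        have h1 : q ^ j.choose 2 * (q ^ (1 / 2 - (n : ℝ))) ^ j =
            q ^ (-((n : ℝ) ^ 2 / 2)) * q ^ ((((j : ℤ) - n : ℤ) : ℝ) ^ 2 / 2) := by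
          rw [← Real.rpow_natCast q, ← Real.rpow_mul_natCast hq.le, ← Real.rpow_add hq,
            ← Real.rpow_add hq, Nat.cast_choose_two]
          congr 1; push_cast; ring
        have h2 : t ^ j = t ^ n * t ^ ((j : ℤ) - n) := by
          rw [zpow_sub₀ ht.ne', zpow_natCast, zpow_natCast]
          field_simp
        rw [mul_pow, h2]
        linear_combination (qChoose q (n + n) j * t ^ n * t ^ ((j : ℤ) - n)) * h1

lemma summable_rpow_sq_div_two_mul_zpow {q t : ℝ} (hq0 : 0 < q) (hq1 : q < 1) (ht : 0 < t) :
    Summable fun c : ℤ => q ^ ((c : ℝ) ^ 2 / 2) * t ^ c := by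
  have h := (summable_jacobiTheta₂_term_iff (⟨0, -Real.log t / (2 * Real.pi)⟩ : ℂ)
    ⟨0, -Real.log q / (2 * Real.pi)⟩).2
      (div_pos (neg_pos.2 (Real.log_neg hq0 hq1)) Real.two_pi_pos)
  refine h.norm.congr fun c => ?_
  rw [norm_jacobiTheta₂_term, Real.rpow_def_of_pos hq0, ← Real.rpow_intCast,
    Real.rpow_def_of_pos ht, ← Real.exp_add]
  congr 1
  field_simp
  ring

lemma summable_rpow_add_half {q : ℝ} (hq0 : 0 < q) (hq1 : q < 1) :
    Summable fun k : ℕ => q ^ ((k : ℝ) + 1 / 2) := by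
  simp_rw [Real.rpow_add hq0, Real.rpow_natCast]
  exact (summable_geometric_of_lt_one hq0.le hq1).mul_right _

lemma tendsto_inv_qPochhammer {q : ℝ} (hq0 : 0 < q) (hq1 : q < 1) :
    Filter.Tendsto (fun n => (qPochhammer q n)⁻¹) Filter.atTop
      (nhds (∏' k : ℕ, (1 - q ^ (k + 1))⁻¹)) := by
  have hlt (k : ℕ) : q ^ (k + 1) < 1 := pow_lt_one₀ hq0.le hq1 k.succ_ne_zero
  have hs : Summable fun k : ℕ => q ^ (k + 1) * (1 - q ^ (k + 1))⁻¹ := by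
    refine Summable.of_nonneg_of_le (fun k => ?_) (fun k => ?_)
      (((summable_geometric_of_lt_one hq0.le hq1).mul_left q).mul_right (1 - q)⁻¹)
    · exact mul_nonneg (by positivity) (inv_nonneg.2 (sub_nonneg.2 (hlt k).le))
    · rw [← pow_succ']
      have : q ^ (k + 1) ≤ q := pow_le_of_le_one hq0.le hq1.le k.succ_ne_zero
      have : 0 < 1 - q := sub_pos.2 hq1
      gcongr
  have hm : Multipliable fun k : ℕ => (1 - q ^ (k + 1))⁻¹ := by
    refine (Real.multipliable_one_add_of_summable hs).congr fun k => ?_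
    have : 1 - q ^ (k + 1) ≠ 0 := (sub_pos.2 (hlt k)).ne'
    field_simp
    ring
  simpa [qPochhammer] using hm.hasProd.tendsto_prod_nat

theorem jacobi_triple_product (q t : ℝ) (hq0 : 0 < q) (hq1 : q < 1) (ht : 0 < t) :
    (∑' c : ℤ, q ^ ((c : ℝ) ^ 2 / 2) * t ^ c) * (∏' k : ℕ, (1 - q ^ (k + 1))⁻¹) =
      ∏' k : ℕ, (1 + q ^ ((k : ℝ) + 1 / 2) * t) * (1 + q ^ ((k : ℝ) + 1 / 2) * t⁻¹) := by
  set M : ℝ := ∏' k : ℕ, (1 - q ^ (k + 1))⁻¹ with hM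
  have hlim := tendsto_inv_qPochhammer hq0 hq1
  rw [← hM] at hlim
  have hP := qPochhammer_pos hq0 hq1
  have hanti := qPochhammer_antitone hq0 hq1
  have hle (n : ℕ) : (qPochhammer q n)⁻¹ ≤ M :=
    Monotone.ge_of_tendsto (fun a b hab => inv_anti₀ (hP b) (hanti hab)) hlim n
  have hM0 : 0 < M := (inv_pos.2 (hP 0)).trans_le (hle 0)
  have hlim' : Filter.Tendsto (qPochhammer q) Filter.atTop (nhds M⁻¹) := by
    simpa using hlim.inv₀ hM0.ne'
  have hclosed (i j : ℕ) : qChoose q (i + j) i =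
      qPochhammer q (i + j) * (qPochhammer q i)⁻¹ * (qPochhammer q j)⁻¹ := by
    have hi := (hP i).ne'
    have hj := (hP j).ne'
    field_simp
    linear_combination qChoose_add_mul q i j
  have hbound (N i : ℕ) : |qChoose q N i| ≤ M := by
    rcases lt_or_ge N i with h | h
    · simp [qChoose_eq_zero_of_lt q h, hM0.le]
    · obtain ⟨j, rfl⟩ := Nat.exists_eq_add_of_le h
      have hi := hP i
      have hj := hP j
      have hij := hP (i + j)
      rw [hclosed, abs_of_pos (by positivity)]
      refine (mul_le_of_le_one_left (by positivity) ?_).trans (hle j)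
      rw [← div_eq_mul_inv]
      exact (div_le_one hi).2 (hanti h)
  let w : ℤ → ℝ := fun c => q ^ ((c : ℝ) ^ 2 / 2) * t ^ c
  have hw0 (c : ℤ) : 0 ≤ w c := by positivity
  let f : ℕ → ℤ → ℝ := fun n c => if -(n : ℤ) ≤ c then qChoose q (2 * n) (c + n).toNat * w c else 0
  have hf (n : ℕ) : ∑' c, f n c =
      ∏ k ∈ Finset.range n,
        (1 + q ^ ((k : ℝ) + 1 / 2) * t) * (1 + q ^ ((k : ℝ) + 1 / 2) * t⁻¹) := by
    rw [prod_one_add_rpow_mul_one_add_rpow hq0 ht, tsum_eq_sum (s := Finset.Icc (-(n : ℤ)) n)]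
    · refine Finset.sum_nbij' (fun c => (c + n).toNat) (fun j => (j : ℤ) - n) ?_ ?_ ?_ ?_ ?_
      · intro c hc
        simp only [Finset.mem_Icc, Finset.mem_range] at *
        omega
      · intro j hj
        simp only [Finset.mem_Icc, Finset.mem_range] at *
        omega
      · intro c hc
        simp only [Finset.mem_Icc] at *
        omega
      · intro j hj
        simp
      · intro c hc
        have hc := (Finset.mem_Icc.1 hc).1
        have h : ((c + n).toNat : ℤ) - n = c := by omega
        simp only [f, w, if_pos hc, h]
    · intro c hc
      simp only [Finset.mem_Icc, not_and, not_le] at hc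
      simp only [f]
      split_ifs with h
      · rw [qChoose_eq_zero_of_lt q (by have := hc h; omega), zero_mul]
      · rfl
  have hfbound (n : ℕ) (c : ℤ) : ‖f n c‖ ≤ M * w c := by
    simp only [f]
    split_ifs
    · rw [norm_mul, Real.norm_of_nonneg (hw0 c)]
      exact mul_le_mul_of_nonneg_right (hbound _ _) (hw0 c)
    · simpa using mul_nonneg hM0.le (hw0 c)
  have hflim (c : ℤ) : Filter.Tendsto (f · c) Filter.atTop (nhds (M * w c)) := by
    have hta : Filter.Tendsto (fun n : ℕ => (n + c).toNat) Filter.atTop Filter.atTop :=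
      Filter.tendsto_atTop.2 fun b => by
        filter_upwards [Filter.eventually_ge_atTop (b + c.natAbs)] with n hn
        omega
    have htb : Filter.Tendsto (fun n : ℕ => (n - c).toNat) Filter.atTop Filter.atTop :=
      Filter.tendsto_atTop.2 fun b => by
        filter_upwards [Filter.eventually_ge_atTop (b + c.natAbs)] with n hn
        omega
    have htwo : Filter.Tendsto (fun n : ℕ => 2 * n) Filter.atTop Filter.atTop :=
      Filter.tendsto_id.const_mul_atTop' two_pos
    have h := (((hlim'.comp htwo).mul (hlim.comp hta)).mul (hlim.comp htb)).mul_const (w c)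
    rw [inv_mul_cancel₀ hM0.ne', one_mul] at h
    refine h.congr' ?_
    filter_upwards [Filter.eventually_ge_atTop c.natAbs] with n hn
    have hsum : 2 * n = (n + c).toNat + (n - c).toNat := by omega
    simp only [f, Function.comp_apply, if_pos (show -(n : ℤ) ≤ c by omega), add_comm c]
    rw [hsum, hclosed]
  have hw : Summable w := summable_rpow_sq_div_two_mul_zpow hq0 hq1 ht
  have hsum := tendsto_tsum_of_dominated_convergence (hw.mul_left M) hflim
    (Filter.Eventually.of_forall hfbound)
  simp_rw [hf] at hsum
  have hs := summable_rpow_add_half hq0 hq1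
  have hmult := (Real.multipliable_one_add_of_summable (hs.mul_right t)).mul
    (Real.multipliable_one_add_of_summable (hs.mul_right t⁻¹))
  rw [tendsto_nhds_unique hmult.hasProd.tendsto_prod_nat hsum, tsum_mul_left, mul_comm]
end
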